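/- arXiv:2512.14979 — 9 statements merged into one kernel-verified Lean document; each statement's English description precedes it below -/
import Mathlib

section
/- Let r : ℝ^n → ℝ ∪ {+∞} be proper, closed and convex, and let h : ℝ^n → ℝ be differentiable on an open set containing dom(r) with ∇h L-Lipschitz on dom(r). Fix x ∈ dom(r) and t > 0, and set x(t) ≜ prox_{t r}(x − t ∇h(x)). Then h(x(t)) + r(x(t)) − (h(x) + r(x)) ≤ (L/2 − 1/t) ‖x − x(t)‖². -/
open MeasureTheory Filter
open scoped RealInnerProductSpace

/-- Quadratic upper bound for a function whose gradient is Lipschitz on a convex set. -/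
theorem sub_le_inner_add_of_gradient_lipschitz {E : Type*} [NormedAddCommGroup E]
    [InnerProductSpace ℝ E] [CompleteSpace E] {S : Set E} (hS : Convex ℝ S) {h : E → ℝ} {g : E → E}
    (hdiff : ∀ z ∈ S, HasGradientAt h (g z) z) {L : ℝ}
    (hglip : ∀ z ∈ S, ∀ w ∈ S, ‖g z - g w‖ ≤ L * ‖z - w‖) {x y : E} (hx : x ∈ S) (hy : y ∈ S) :
    h y - h x ≤ ⟪g x, y - x⟫ + L / 2 * ‖y - x‖ ^ 2 := by
  set d := y - x with hd
  have hmem : ∀ s ∈ Set.Icc (0 : ℝ) 1, x + s • d ∈ S := fun s hs =>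
    hS.add_smul_sub_mem hx hy hs
  have hderiv : ∀ s ∈ Set.Icc (0 : ℝ) 1,
      HasDerivAt (fun s : ℝ => h (x + s • d) - s * ⟪g x, d⟫ - s ^ 2 * (L / 2 * ‖d‖ ^ 2))
        (⟪g (x + s • d), d⟫ - ⟪g x, d⟫ - 2 * s * (L / 2 * ‖d‖ ^ 2)) s := by
    intro s hs
    have hline : HasDerivAt (fun s : ℝ => x + s • d) d s := by
      simpa using ((hasDerivAt_id s).smul_const d).const_add x
    have hcomp := (hdiff _ (hmem s hs)).hasFDerivAt.comp_hasDerivAt s hline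
    have hcomp' : HasDerivAt (fun s : ℝ => h (x + s • d)) ⟪g (x + s • d), d⟫ s := by
      simpa [Function.comp_def] using hcomp
    have hlin : HasDerivAt (fun s : ℝ => s * ⟪g x, d⟫) ⟪g x, d⟫ s := by
      simpa using (hasDerivAt_id s).mul_const ⟪g x, d⟫
    have hsq : HasDerivAt (fun s : ℝ => s ^ 2 * (L / 2 * ‖d‖ ^ 2))
        (2 * s * (L / 2 * ‖d‖ ^ 2)) s := by
      simpa using (hasDerivAt_pow 2 s).mul_const (L / 2 * ‖d‖ ^ 2)
    exact (hcomp'.sub hlin).sub hsq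
  have hanti := antitoneOn_of_hasDerivWithinAt_nonpos (convex_Icc (0 : ℝ) 1)
    (fun s hs => (hderiv s hs).continuousAt.continuousWithinAt)
    (fun s hs => (hderiv s (interior_subset hs)).hasDerivWithinAt) (by
      intro s hs
      have hs' := interior_subset hs
      have hlip := hglip _ (hmem s hs') _ hx
      rw [add_sub_cancel_left, norm_smul, Real.norm_of_nonneg hs'.1] at hlip
      have hcs := real_inner_le_norm (g (x + s • d) - g x) d
      rw [inner_sub_left] at hcs
      nlinarith [mul_le_mul_of_nonneg_right hlip (norm_nonneg d)])
  have h01 := hanti (Set.left_mem_Icc.2 zero_le_one) (Set.right_mem_Icc.2 zero_le_one) zero_le_one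
  simp only [hd, one_smul, add_sub_cancel, zero_smul, add_zero] at h01
  rw [hd]
  linarith

/-- Variational inequality satisfied by a minimizer of `r y + ‖y - z‖ ^ 2 / (2 * t)`. -/
theorem ConvexOn.sub_le_inner_div_of_prox {E : Type*} [NormedAddCommGroup E]
    [InnerProductSpace ℝ E] {S : Set E} {r : E → ℝ} (hr : ConvexOn ℝ S r) {t : ℝ} (ht : 0 < t)
    {p z : E} (hp : p ∈ S)
    (hmin : ∀ y ∈ S, r p + ‖p - z‖ ^ 2 / (2 * t) ≤ r y + ‖y - z‖ ^ 2 / (2 * t))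
    {x : E} (hx : x ∈ S) : r p - r x ≤ ⟪x - p, p - z⟫ / t := by
  have hbound : ∀ s ∈ Set.Ioo (0 : ℝ) 1,
      r p - r x ≤ ⟪x - p, p - z⟫ / t + s * (‖x - p‖ ^ 2 / (2 * t)) := by
    rintro s ⟨hs0, hs1⟩
    have hconv := hr.2 hp hx (sub_nonneg.2 hs1.le) hs0.le (by ring)
    have hle := hmin _ (hr.1 hp hx (sub_nonneg.2 hs1.le) hs0.le (by ring))
    have hvec : (1 - s) • p + s • x - z = (p - z) + s • (x - p) := by module
    rw [hvec, norm_add_sq_real, norm_smul, inner_smul_right, Real.norm_of_nonneg hs0.le,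
      real_inner_comm] at hle
    simp only [smul_eq_mul] at hconv
    have hsplit : (‖p - z‖ ^ 2 + 2 * (s * ⟪x - p, p - z⟫) + (s * ‖x - p‖) ^ 2) / (2 * t)
        = ‖p - z‖ ^ 2 / (2 * t)
          + s * (⟪x - p, p - z⟫ / t + s * (‖x - p‖ ^ 2 / (2 * t))) := by
      field_simp
      ring
    rw [hsplit] at hle
    refine le_of_mul_le_mul_left ?_ hs0
    linarith
  have hlim : Tendsto (fun s : ℝ => ⟪x - p, p - z⟫ / t + s * (‖x - p‖ ^ 2 / (2 * t)))
      (nhdsWithin 0 (Set.Ioi 0)) (nhds (⟪x - p, p - z⟫ / t)) := by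
    have hcont : Continuous fun s : ℝ => ⟪x - p, p - z⟫ / t + s * (‖x - p‖ ^ 2 / (2 * t)) := by
      fun_prop
    simpa using (hcont.tendsto 0).mono_left nhdsWithin_le_nhds
  exact ge_of_tendsto hlim (mem_of_superset (Ioo_mem_nhdsGT one_pos) hbound)

theorem stmt0 {n : ℕ}
    (S : Set (EuclideanSpace ℝ (Fin n))) (hSne : S.Nonempty) (hSclosed : IsClosed S)
    (r : EuclideanSpace ℝ (Fin n) → ℝ) (hrconv : ConvexOn ℝ S r)
    (prox : ℝ → EuclideanSpace ℝ (Fin n) → EuclideanSpace ℝ (Fin n))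
    (hprox_mem : ∀ t : ℝ, 0 < t → ∀ z, prox t z ∈ S)
    (hprox_min : ∀ t : ℝ, 0 < t → ∀ z, ∀ y ∈ S,
      r (prox t z) + ‖prox t z - z‖ ^ 2 / (2 * t) ≤ r y + ‖y - z‖ ^ 2 / (2 * t))
    (hprox_uniq : ∀ t : ℝ, 0 < t → ∀ z, ∀ y ∈ S,
      (∀ y' ∈ S, r y + ‖y - z‖ ^ 2 / (2 * t) ≤ r y' + ‖y' - z‖ ^ 2 / (2 * t)) → y = prox t z)
    (h : EuclideanSpace ℝ (Fin n) → ℝ) (g : EuclideanSpace ℝ (Fin n) → EuclideanSpace ℝ (Fin n))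
    (U : Set (EuclideanSpace ℝ (Fin n))) (hU : IsOpen U) (hSU : S ⊆ U)
    (hdiff : ∀ z ∈ U, HasGradientAt h (g z) z)
    (L : ℝ) (hL : 0 ≤ L)
    (hglip : ∀ z ∈ S, ∀ w ∈ S, ‖g z - g w‖ ≤ L * ‖z - w‖)
    (x : EuclideanSpace ℝ (Fin n)) (hx : x ∈ S) (t : ℝ) (ht : 0 < t) :
    h (prox t (x - t • g x)) + r (prox t (x - t • g x)) - (h x + r x)
      ≤ (L / 2 - 1 / t) * ‖x - prox t (x - t • g x)‖ ^ 2 := by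
  have hp := hprox_mem t ht (x - t • g x)
  have hmin := hprox_min t ht (x - t • g x)
  set p := prox t (x - t • g x)
  have hdescent := sub_le_inner_add_of_gradient_lipschitz hrconv.1
    (fun z hz => hdiff z (hSU hz)) hglip hx hp
  have hvar := hrconv.sub_le_inner_div_of_prox ht hp hmin hx
  have hinner : ⟪x - p, p - (x - t • g x)⟫ / t = -(1 / t) * ‖x - p‖ ^ 2 - ⟪g x, p - x⟫ := by
    have hvec : p - (x - t • g x) = t • g x - (x - p) := by module
    rw [hvec, inner_sub_right, inner_smul_right, real_inner_self_eq_norm_sq, real_inner_comm,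
      ← neg_sub p x, inner_neg_right]
    field_simp
    ring
  rw [hinner] at hvar
  rw [norm_sub_rev p x] at hdescent
  linarith
end

section
/- Let r : ℝ^n → ℝ ∪ {+∞} be proper, closed and convex, let h : ℝ^n → ℝ be differentiable on an open set containing dom(r) with ∇h L-Lipschitz on dom(r), let α, β ∈ (0,1) and s > 0, and fix x ∈ dom(r). For τ > 0 set x(τ) ≜ prox_{τ r}(x − τ ∇h(x)), and say that τ satisfies the Armijo condition if h(x(τ)) + r(x(τ)) − (h(x) + r(x)) ≤ −(α/τ)‖x − x(τ)‖². Suppose t ∈ (0, s] satisfies: either t = s, or the trial value t/β violates the Armijo condition. Then t ≥ min{s, 2(1−α)β/L}. In particular, every stepsize accepted by backtracking linesearch (repeatedly multiplying an initial stepsize in (0, s] by β until the Armijo condition holds) lies in [min{s, 2(1−α)β/L}, s]. -/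
open MeasureTheory Filter
open scoped RealInnerProductSpace

/-- The descent lemma on a convex set: a function whose gradient is `L`-Lipschitz on `S` is bounded
above on `S` by its quadratic model. -/
theorem descent_lemma_of_convex {E : Type*} [NormedAddCommGroup E] [InnerProductSpace ℝ E]
    [CompleteSpace E] {S : Set E} (hS : Convex ℝ S) {h : E → ℝ} {g : E → E} {L : ℝ}
    (hdiff : ∀ z ∈ S, HasGradientAt h (g z) z)
    (hglip : ∀ z ∈ S, ∀ w ∈ S, ‖g z - g w‖ ≤ L * ‖z - w‖)
    {x y : E} (hx : x ∈ S) (hy : y ∈ S) :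
    h y ≤ h x + ⟪g x, y - x⟫ + L / 2 * ‖y - x‖ ^ 2 := by
  set d := y - x with hd
  have hmem : ∀ u ∈ Set.Icc (0 : ℝ) 1, x + u • d ∈ S := fun u hu =>
    hS.add_smul_sub_mem hx hy hu
  have hderiv : ∀ u ∈ Set.Icc (0 : ℝ) 1,
      HasDerivAt (fun u : ℝ => h (x + u • d) - u * ⟪g x, d⟫ - L / 2 * ‖d‖ ^ 2 * u ^ 2)
        (⟪g (x + u • d), d⟫ - ⟪g x, d⟫ - L * ‖d‖ ^ 2 * u) u := by
    intro u hu
    have hline : HasDerivAt (fun u : ℝ => x + u • d) d u := by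
      simpa using ((hasDerivAt_id u).smul_const d).const_add x
    have hcomp : HasDerivAt (fun u : ℝ => h (x + u • d)) ⟪g (x + u • d), d⟫ u := by
      simpa [Function.comp_def] using
        (hdiff _ (hmem u hu)).hasFDerivAt.comp_hasDerivAt u hline
    have hlin : HasDerivAt (fun u : ℝ => u * ⟪g x, d⟫) ⟪g x, d⟫ u := by
      simpa using (hasDerivAt_id u).mul_const ⟪g x, d⟫
    have hquad := (hasDerivAt_pow 2 u).const_mul (L / 2 * ‖d‖ ^ 2)
    refine ((hcomp.sub hlin).sub hquad).congr_deriv ?_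
    push_cast
    ring
  have hanti := antitoneOn_of_deriv_nonpos (convex_Icc (0 : ℝ) 1)
    (fun u hu => (hderiv u hu).continuousAt.continuousWithinAt)
    (fun u hu => (hderiv u (interior_subset hu)).differentiableAt.differentiableWithinAt)
    (fun u hu => by
      have hu' := interior_subset hu
      rw [(hderiv u hu').deriv, ← inner_sub_left]
      have hinner := real_inner_le_norm (g (x + u • d) - g x) d
      have hlip := hglip _ (hmem u hu') x hx
      rw [add_sub_cancel_left, norm_smul, Real.norm_of_nonneg hu'.1] at hlip
      nlinarith [mul_le_mul_of_nonneg_right hlip (norm_nonneg d)])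
  have h01 := hanti (Set.left_mem_Icc.2 zero_le_one) (Set.right_mem_Icc.2 zero_le_one) zero_le_one
  have hxd : x + d = y := by simp [hd]
  simp only [one_smul, zero_smul, hxd, add_zero] at h01
  linarith

/-- The variational inequality satisfied by a minimizer `p` of the proximal objective. -/
theorem ConvexOn.le_add_inner_of_prox_minimizer {E : Type*} [NormedAddCommGroup E]
    [InnerProductSpace ℝ E] {S : Set E} {r : E → ℝ} (hr : ConvexOn ℝ S r) {τ : ℝ} (hτ : 0 < τ)
    {z p y : E} (hp : p ∈ S)
    (hmin : ∀ w ∈ S, r p + ‖p - z‖ ^ 2 / (2 * τ) ≤ r w + ‖w - z‖ ^ 2 / (2 * τ)) (hy : y ∈ S) :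
    r p ≤ r y + ⟪p - z, y - p⟫ / τ := by
  have key : ∀ l ∈ Set.Ioo (0 : ℝ) 1,
      r p ≤ r y + ⟪p - z, y - p⟫ / τ + l * (‖y - p‖ ^ 2 / (2 * τ)) := by
    intro l hl
    have hm := hmin _ (hr.1.add_smul_sub_mem hp hy ⟨hl.1.le, hl.2.le⟩)
    have hc := hr.2 hp hy (sub_nonneg.2 hl.2.le) hl.1.le (sub_add_cancel 1 l)
    have hpt : (1 - l) • p + l • y = p + l • (y - p) := by module
    have hnorm : ‖p + l • (y - p) - z‖ ^ 2
        = ‖p - z‖ ^ 2 + 2 * (l * ⟪p - z, y - p⟫) + l ^ 2 * ‖y - p‖ ^ 2 := by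
      rw [add_sub_right_comm, norm_add_sq_real, real_inner_smul_right, norm_smul, mul_pow,
        Real.norm_eq_abs, sq_abs]
    rw [hpt, smul_eq_mul, smul_eq_mul] at hc
    rw [hnorm] at hm
    have hsplit : (‖p - z‖ ^ 2 + 2 * (l * ⟪p - z, y - p⟫) + l ^ 2 * ‖y - p‖ ^ 2) / (2 * τ)
        = ‖p - z‖ ^ 2 / (2 * τ) + l * (⟪p - z, y - p⟫ / τ)
          + l * (l * (‖y - p‖ ^ 2 / (2 * τ))) := by
      field_simp
    rw [hsplit] at hm
    refine le_of_mul_le_mul_left ?_ hl.1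
    linarith
  have hlim : Tendsto (fun l : ℝ => r y + ⟪p - z, y - p⟫ / τ + l * (‖y - p‖ ^ 2 / (2 * τ)))
      (nhdsWithin 0 (Set.Ioi 0)) (nhds (r y + ⟪p - z, y - p⟫ / τ)) := by
    have hcont : Continuous
        (fun l : ℝ => r y + ⟪p - z, y - p⟫ / τ + l * (‖y - p‖ ^ 2 / (2 * τ))) := by fun_prop
    simpa using (hcont.tendsto 0).mono_left nhdsWithin_le_nhds
  refine ge_of_tendsto hlim ?_
  filter_upwards [Ioo_mem_nhdsGT (zero_lt_one' ℝ)] with l hl using key l hl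

theorem stmt1 {n : ℕ}
    (S : Set (EuclideanSpace ℝ (Fin n))) (hSne : S.Nonempty) (hSclosed : IsClosed S)
    (r : EuclideanSpace ℝ (Fin n) → ℝ) (hrconv : ConvexOn ℝ S r)
    (prox : ℝ → EuclideanSpace ℝ (Fin n) → EuclideanSpace ℝ (Fin n))
    (hprox_mem : ∀ t : ℝ, 0 < t → ∀ z, prox t z ∈ S)
    (hprox_min : ∀ t : ℝ, 0 < t → ∀ z, ∀ y ∈ S,
      r (prox t z) + ‖prox t z - z‖ ^ 2 / (2 * t) ≤ r y + ‖y - z‖ ^ 2 / (2 * t))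
    (hprox_uniq : ∀ t : ℝ, 0 < t → ∀ z, ∀ y ∈ S,
      (∀ y' ∈ S, r y + ‖y - z‖ ^ 2 / (2 * t) ≤ r y' + ‖y' - z‖ ^ 2 / (2 * t)) → y = prox t z)
    (h : EuclideanSpace ℝ (Fin n) → ℝ) (g : EuclideanSpace ℝ (Fin n) → EuclideanSpace ℝ (Fin n))
    (U : Set (EuclideanSpace ℝ (Fin n))) (hU : IsOpen U) (hSU : S ⊆ U)
    (hdiff : ∀ z ∈ U, HasGradientAt h (g z) z)
    (L : ℝ) (hL : 0 < L)
    (hglip : ∀ z ∈ S, ∀ w ∈ S, ‖g z - g w‖ ≤ L * ‖z - w‖)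
    (α β s : ℝ) (hα : α ∈ Set.Ioo (0:ℝ) 1) (hβ : β ∈ Set.Ioo (0:ℝ) 1) (hs : 0 < s)
    (x : EuclideanSpace ℝ (Fin n)) (hx : x ∈ S) (t : ℝ) (ht : 0 < t) (hts : t ≤ s)
    (hacc : t = s ∨
      ¬ (h (prox (t / β) (x - (t / β) • g x)) + r (prox (t / β) (x - (t / β) • g x))
            - (h x + r x)
          ≤ -(α / (t / β)) * ‖x - prox (t / β) (x - (t / β) • g x)‖ ^ 2)) :
    min s (2 * (1 - α) * β / L) ≤ t ∧ t ≤ s := by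
  refine ⟨?_, hts⟩
  rcases hacc with rfl | hviol
  · exact min_le_left _ _
  refine (min_le_right _ _).trans ?_
  have hT : 0 < t / β := div_pos ht hβ.1
  have htT : t = t / β * β := (div_mul_cancel₀ t hβ.1.ne').symm
  generalize t / β = T at *
  have hpS := hprox_mem T hT (x - T • g x)
  have hprox := hrconv.le_add_inner_of_prox_minimizer hT hpS
    (hprox_min T hT (x - T • g x)) hx
  generalize prox T (x - T • g x) = p at *
  have hdesc := descent_lemma_of_convex hrconv.1 (fun z hz => hdiff z (hSU hz)) hglip hx hpS
  have hinner : ⟪p - (x - T • g x), x - p⟫ / T = -(‖p - x‖ ^ 2 / T) - ⟪g x, p - x⟫ := by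
    have hz : p - (x - T • g x) = (p - x) + T • g x := by module
    rw [hz, ← neg_sub p x, inner_neg_right, inner_add_left, real_inner_self_eq_norm_sq,
      real_inner_smul_left]
    field_simp
    ring
  rw [hinner] at hprox
  rw [norm_sub_rev x p, not_le] at hviol
  have hlt : 0 < (L / 2 - (1 - α) / T) * ‖p - x‖ ^ 2 := by
    have hexp : (L / 2 - (1 - α) / T) * ‖p - x‖ ^ 2
        = L / 2 * ‖p - x‖ ^ 2 - ‖p - x‖ ^ 2 / T + α / T * ‖p - x‖ ^ 2 := by ring
    linarith
  have hstep := sub_pos.1 (pos_of_mul_pos_left hlt (sq_nonneg _))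
  rw [div_lt_iff₀ hT] at hstep
  rw [div_le_iff₀ hL, htT]
  nlinarith [mul_lt_mul_of_pos_right hstep hβ.1]
end

section
/- Let β ∈ (0,1), α ∈ (0,1), s > 0, L > 0 and p ∈ ℕ∖{0}. Let (j_k)_{k=0}^{p−1} ⊆ ℕ be a nondecreasing sequence of nonnegative integers such that s β^{j_k} > 2(1−α)β/L whenever j_k ≥ 1, and set t_k ≜ s β^{j_k}. Then the number of indices k ∈ {1, …, p−1} with t_k ≠ t_{k−1} is at most ⌈[log_{1/β}(sL/(2(1−α)))]_+ + 1⌉, where [u]_+ ≜ max{u, 0}. -/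
/-- A nondecreasing sequence of naturals changes value at most `j n` times up to index `n`. -/
theorem card_changes_le {γ : Type*} [DecidableEq γ] (f : ℕ → γ) (j : ℕ → ℕ) (n : ℕ)
    (hmono : ∀ k l : ℕ, k ≤ l → l ≤ n → j k ≤ j l) :
    ((Finset.Ico 1 (n + 1)).filter (fun k => f (j k) ≠ f (j (k - 1)))).card ≤ j n := by
  induction n with
  | zero => simp
  | succ n ih =>
    have ih := ih fun k l hkl hl => hmono k l hkl (by omega)
    have hle := hmono n (n + 1) (by omega) le_rfl
    rw [← Finset.insert_Ico_right_eq_Ico_add_one (by omega : 1 ≤ n + 1), Finset.filter_insert]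
    split_ifs with h
    · have hne : j (n + 1) ≠ j n := fun he => h (by simp [he])
      exact (Finset.card_insert_le _ _).trans (by omega)
    · exact ih.trans hle

/-- An exponent whose power of `β` stays above `β / c` is less than `log_{1/β} c + 1`. -/
theorem lt_logb_add_one_of_div_lt_pow {β c : ℝ} (hβ0 : 0 < β) (hβ1 : β < 1) (hc : 0 < c) {n : ℕ}
    (h : β / c < β ^ n) : (n : ℝ) < Real.logb (1 / β) c + 1 := by
  have hb : 1 < 1 / β := by rwa [lt_div_iff₀ hβ0, one_mul]
  have hlt : (1 / β) ^ ((n : ℝ) - 1) < c := by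
    rw [Real.rpow_sub_one (by positivity), Real.rpow_natCast, one_div_pow]
    rw [div_lt_iff₀ hc] at h
    rw [one_div, one_div, div_inv_eq_mul, inv_mul_lt_iff₀ (by positivity)]
    exact h
  have := (Real.lt_logb_iff_rpow_lt hb hc).mpr hlt
  linarith

theorem stmt2 (β α s L : ℝ) (hβ : β ∈ Set.Ioo (0:ℝ) 1) (hα : α ∈ Set.Ioo (0:ℝ) 1)
    (hs : 0 < s) (hL : 0 < L) (p : ℕ) (hp : 0 < p)
    (j : ℕ → ℕ) (hmono : ∀ k l : ℕ, k ≤ l → l < p → j k ≤ j l)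
    (hbig : ∀ k : ℕ, k < p → 1 ≤ j k → 2 * (1 - α) * β / L < s * β ^ (j k)) :
    ((((Finset.Ico 1 p).filter (fun k => s * β ^ (j k) ≠ s * β ^ (j (k - 1)))).card : ℤ))
      ≤ ⌈max (Real.logb (1 / β) (s * L / (2 * (1 - α)))) 0 + 1⌉ := by
  obtain ⟨n, rfl⟩ := Nat.exists_eq_add_one.mpr hp
  have hα' : 0 < 1 - α := sub_pos.mpr hα.2
  have hcard := card_changes_le (fun i => s * β ^ i) j n
    fun k l hkl hl => hmono k l hkl (Nat.lt_succ_of_le hl)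
  refine (Int.ofNat_le.mpr hcard).trans ((Int.cast_le (R := ℝ)).mp ?_)
  rw [Int.cast_natCast]
  refine le_trans ?_ (Int.le_ceil _)
  rcases Nat.eq_zero_or_pos (j n) with h0 | hpos
  · rw [h0, Nat.cast_zero]
    positivity
  · have hpow : β / (s * L / (2 * (1 - α))) < β ^ j n := by
      have h := hbig n n.lt_succ_self hpos
      rw [div_lt_iff₀ hL] at h
      rw [div_div_eq_mul_div, div_lt_iff₀ (by positivity)]
      linarith
    have h := lt_logb_add_one_of_div_lt_pow hβ.1 hβ.2 (by positivity) hpow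
    exact h.le.trans (by gcongr; exact le_max_left _ _)
end

section
/- Let β ∈ (0,1), α ∈ (0,1), s > 0, L > 0, K ∈ ℕ∖{0}, and let (p_j)_{j≥0} be a sequence of positive integers with J(K) ≜ min{ l ∈ ℕ : Σ_{j=0}^{l} p_j ≥ K }. Partition the index set {0, …, K−1} into J(K)+1 consecutive cycles of lengths p_0, p_1, …, with the last cycle possibly truncated. Suppose the sequence (t_k)_{k=0}^{K−1} satisfies: within each cycle, (t_k) is nonincreasing, every t_k is of the form s β^j with j ∈ ℕ, and whenever t_k < t_{k−1} within a cycle one has t_k > 2(1−α)β/L. Then, setting t_{−1} ≜ s, the number of indices k ∈ {0, …, K−1} with t_k ≠ t_{k−1} is at most (J(K)+1) ⌈[log_{1/β}(sL/(2(1−α)))]_+ + 2⌉, where [u]_+ ≜ max{u, 0}. -/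
open MeasureTheory Filter
open scoped RealInnerProductSpace

/-- If the first `J + 1` consecutive blocks of lengths `p 0, p 1, …` cover `k`, then `k` lies in a
block of index at most `J`. -/
theorem exists_block_of_lt_sum (p : ℕ → ℕ) {J k : ℕ}
    (hk : k < ∑ j ∈ Finset.range (J + 1), p j) :
    ∃ l ≤ J, ∑ j ∈ Finset.range l, p j ≤ k ∧ k < ∑ j ∈ Finset.range (l + 1), p j := by
  classical
  have hex : ∃ l, k < ∑ j ∈ Finset.range (l + 1), p j := ⟨J, hk⟩
  refine ⟨Nat.find hex, Nat.find_min' hex hk, ?_, Nat.find_spec hex⟩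
  rcases h : Nat.find hex with _ | n
  · simp
  · exact not_lt.mp (Nat.find_min hex (m := n) (by omega))

/-- A sequence that is nonincreasing at every step of the interval `[a, b]` satisfies
`t b ≤ t a`. -/
theorem le_of_forall_succ_le {t : ℕ → ℝ} {a b : ℕ} (hab : a ≤ b)
    (h : ∀ k, a ≤ k → k + 1 ≤ b → t (k + 1) ≤ t k) : t b ≤ t a := by
  induction b, hab using Nat.le_induction with
  | base => exact le_rfl
  | succ n hn ih =>
    exact (h n hn le_rfl).trans (ih fun k hk hkn => h k hk (by omega))

/-- A backtracked stepsize `s * β ^ (n + 1)` above the Armijo threshold `c * β / L` has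
`n < log_{1/β} (s * L / c)`. -/
theorem lt_logb_of_threshold_lt {β s L c : ℝ} (hβ₀ : 0 < β) (hβ₁ : β < 1) (hs : 0 < s)
    (hL : 0 < L) (hc : 0 < c) {n : ℕ} (h : c * β / L < s * β ^ (n + 1)) :
    (n : ℝ) < Real.logb (1 / β) (s * L / c) := by
  rw [Real.lt_logb_iff_rpow_lt (one_lt_one_div hβ₀ hβ₁) (by positivity), Real.rpow_natCast,
    one_div_pow, div_lt_div_iff₀ (by positivity) hc]
  rw [div_lt_iff₀ hL, pow_succ] at h
  refine lt_of_mul_lt_mul_right ?_ hβ₀.le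
  linarith

theorem stmt3 (β α s L : ℝ) (hβ : β ∈ Set.Ioo (0:ℝ) 1) (hα : α ∈ Set.Ioo (0:ℝ) 1)
    (hs : 0 < s) (hL : 0 < L) (K : ℕ) (hK : 1 ≤ K)
    (p : ℕ → ℕ) (hp : ∀ j, 0 < p j)
    (J : ℕ)
    (hJ : K ≤ ∑ j ∈ Finset.range (J + 1), p j)
    (hJmin : ∀ l : ℕ, K ≤ ∑ j ∈ Finset.range (l + 1), p j → J ≤ l)
    (t : ℕ → ℝ)
    (hform : ∀ k < K, ∃ m : ℕ, t k = s * β ^ m)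
    (hmono : ∀ k : ℕ, k + 1 < K →
      (∃ l, (∑ j ∈ Finset.range l, p j) ≤ k ∧ k + 1 < ∑ j ∈ Finset.range (l + 1), p j) →
      t (k + 1) ≤ t k)
    (hdec : ∀ k : ℕ, k + 1 < K →
      (∃ l, (∑ j ∈ Finset.range l, p j) ≤ k ∧ k + 1 < ∑ j ∈ Finset.range (l + 1), p j) →
      t (k + 1) < t k → 2 * (1 - α) * β / L < t (k + 1)) :
    (((Finset.range K).filter (fun k => t k ≠ if k = 0 then s else t (k - 1))).card : ℤ)
      ≤ ((J : ℤ) + 1) * ⌈max (Real.logb (1 / β) (s * L / (2 * (1 - α)))) 0 + 2⌉ := by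
  obtain ⟨hβ₀, hβ₁⟩ := hβ
  have hc : 0 < 2 * (1 - α) := by linarith [hα.2]
  set u := Real.logb (1 / β) (s * L / (2 * (1 - α)))
  choose! m hm using hform
  choose! c hcJ hcl hcu using fun k (hk : k < K) => exists_block_of_lt_sum p (hk.trans_le hJ)
  set P : ℕ → ℕ := fun l => ∑ j ∈ Finset.range l, p j
  have anti : ∀ l a b, a ≤ b → P l ≤ a → b < P (l + 1) → b < K → t b ≤ t a := by
    intro l a b hab hla hbl hbK
    refine le_of_forall_succ_le hab fun k hk hkb => hmono k (by omega) ⟨l, ?_, ?_⟩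
    · exact hla.trans hk
    · exact hkb.trans_lt hbl
  have hdrop : ∀ k < K, t k ≠ (if k = 0 then s else t (k - 1)) → k ≠ P (c k) →
      t k < t (k - 1) ∧ 0 < m k ∧ m k ≤ ⌈max u 0⌉₊ := by
    intro k hk hne hstart
    have hlk : P (c k) ≤ k := hcl k hk
    obtain ⟨i, rfl⟩ : ∃ i, k = i + 1 := Nat.exists_eq_succ_of_ne_zero (by omega)
    simp only [Nat.add_eq_zero_iff, one_ne_zero, and_false, if_false, Nat.add_sub_cancel] at hne ⊢
    have hblock : ∃ l, (∑ j ∈ Finset.range l, p j) ≤ i ∧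
        i + 1 < ∑ j ∈ Finset.range (l + 1), p j :=
      ⟨c (i + 1), show P (c (i + 1)) ≤ i by omega, hcu _ hk⟩
    have hlt : t (i + 1) < t i := lt_of_le_of_ne (hmono i hk hblock) hne
    have hthr := hdec i hk hblock hlt
    have hpos : 0 < m (i + 1) := by
      rw [Nat.pos_iff_ne_zero]
      intro h0
      have h1 : t i ≤ s := by
        rw [hm i (by omega)]
        exact mul_le_of_le_one_right hs.le (pow_le_one₀ hβ₀.le hβ₁.le)
      have h2 : t (i + 1) = s := by rw [hm _ hk, h0, pow_zero, mul_one]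
      linarith
    refine ⟨hlt, hpos, ?_⟩
    obtain ⟨n, hn⟩ : ∃ n, m (i + 1) = n + 1 := Nat.exists_eq_succ_of_ne_zero hpos.ne'
    rw [hm _ hk, hn] at hthr
    have hnu := lt_logb_of_threshold_lt hβ₀ hβ₁ hs hL hc hthr
    rw [hn, Nat.succ_le_iff, Nat.lt_ceil]
    exact lt_max_of_lt_left hnu
  have hcard : ((Finset.range K).filter
      (fun k => t k ≠ if k = 0 then s else t (k - 1))).card ≤ (J + 1) * (⌈max u 0⌉₊ + 1) := by
    rw [← Finset.card_range (J + 1), ← Finset.card_range (⌈max u 0⌉₊ + 1), ← Finset.card_product]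
    refine Finset.card_le_card_of_injOn
      (fun k => (c k, if k = P (c k) then 0 else m k)) ?_ ?_
    · intro k hk
      simp only [Finset.coe_filter, Finset.mem_range, Set.mem_ofPred_eq] at hk
      simp only [Finset.coe_product, Finset.coe_range, Set.mem_prod, Set.mem_Iio]
      refine ⟨Nat.lt_succ_of_le (hcJ k hk.1), ?_⟩
      split_ifs with h
      · omega
      · exact Nat.lt_succ_of_le (hdrop k hk.1 hk.2 h).2.2
    · have key : ∀ a b, a < b → b < K → a < K → t b ≠ (if b = 0 then s else t (b - 1)) →
          t a ≠ (if a = 0 then s else t (a - 1)) → c a = c b →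
          (if a = P (c a) then 0 else m a) ≠ (if b = P (c b) then 0 else m b) := by
        intro a b hab hb ha hbne hane hcab heq
        have hla : P (c a) ≤ a := hcl a ha
        have hub : b < P (c b + 1) := hcu b hb
        have hbs : b ≠ P (c b) := by rw [← hcab]; omega
        obtain ⟨hlt, hpos, -⟩ := hdrop b hb hbne hbs
        rw [if_neg hbs] at heq
        split_ifs at heq with has
        · omega
        · have h1 : t (b - 1) ≤ t a :=
            anti (c a) a (b - 1) (by omega) hla (by rw [hcab]; omega) (by omega)
          have h2 : t a = t b := by rw [hm a ha, hm b hb, heq]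
          linarith
      intro a ha b hb hab
      simp only [Finset.coe_filter, Finset.mem_range, Set.mem_ofPred_eq] at ha hb
      simp only [Prod.mk.injEq] at hab
      rcases lt_trichotomy a b with h | h | h
      · exact absurd hab.2 (key a b h hb.1 ha.1 hb.2 ha.2 hab.1)
      · exact h
      · exact absurd hab.2.symm (key b a h ha.1 hb.1 ha.2 hb.2 hab.1.symm)
  have hceil : ((⌈max u 0⌉₊ + 1 : ℕ) : ℤ) ≤ ⌈max u 0 + 2⌉ := by
    rw [Int.ceil_add_ofNat, Nat.cast_add, Int.natCast_ceil_eq_ceil (le_max_right u 0)]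
    push_cast
    linarith
  calc _ ≤ (((J + 1) * (⌈max u 0⌉₊ + 1) : ℕ) : ℤ) := by exact_mod_cast hcard
    _ = ((J : ℤ) + 1) * ((⌈max u 0⌉₊ + 1 : ℕ) : ℤ) := by push_cast; ring
    _ ≤ _ := mul_le_mul_of_nonneg_left hceil (by positivity)
end

section
/- Let r : ℝ^n → ℝ ∪ {+∞} be proper, closed, convex, and L_r-Lipschitz continuous on its effective domain dom(r). Let f be differentiable at x ∈ dom(r) with ‖∇f(x)‖ ≤ B_g, and let t > 0. Define G_t(x) ≜ (x − prox_{t r}(x − t ∇f(x)))/t. Then ‖t G_t(x)‖ ≤ t (B_g + L_r), i.e., ‖x − prox_{t r}(x − t ∇f(x))‖ ≤ t (B_g + L_r). -/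
open MeasureTheory Filter
open scoped RealInnerProductSpace

/-- If `p` minimizes `r + ‖· - u‖ ^ 2 / (2 * t)` over a convex set on which `r` grows from `p` at
rate at most `L`, then `⟪u - p, x - p⟫ ≤ t * L * ‖x - p‖` up to an arbitrarily small multiple of
`‖x - p‖ ^ 2`. -/
theorem inner_sub_le_of_prox_min {E : Type*} [NormedAddCommGroup E] [InnerProductSpace ℝ E]
    {S : Set E} (hS : Convex ℝ S) {r : E → ℝ} {L t : ℝ} (ht : 0 < t) {p u x : E} (hp : p ∈ S)
    (hx : x ∈ S) (hlip : ∀ y ∈ S, r y - r p ≤ L * ‖y - p‖)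
    (hmin : ∀ y ∈ S, r p + ‖p - u‖ ^ 2 / (2 * t) ≤ r y + ‖y - u‖ ^ 2 / (2 * t))
    {l : ℝ} (hl : 0 < l) (hl1 : l ≤ 1) :
    2 * ⟪u - p, x - p⟫ ≤ 2 * t * L * ‖x - p‖ + l * ‖x - p‖ ^ 2 := by
  have hy : p + l • (x - p) ∈ S := hS.add_smul_sub_mem hp hx ⟨hl.le, hl1⟩
  have h1 := hlip _ hy
  have h2 := hmin _ hy
  rw [add_sub_cancel_left, norm_smul, Real.norm_of_nonneg hl.le] at h1
  have h3 : ‖p + l • (x - p) - u‖ ^ 2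
      = ‖p - u‖ ^ 2 - 2 * l * ⟪u - p, x - p⟫ + l ^ 2 * ‖x - p‖ ^ 2 := by
    rw [show p + l • (x - p) - u = (p - u) + l • (x - p) by abel, norm_add_sq_real,
      norm_smul, inner_smul_right, ← neg_sub u p, inner_neg_left, mul_pow, Real.norm_eq_abs,
      sq_abs]
    ring
  have h4 : ‖p - u‖ ^ 2 / (2 * t) ≤ (2 * t * (L * (l * ‖x - p‖))
      + ‖p + l • (x - p) - u‖ ^ 2) / (2 * t) := by
    rw [add_div, mul_div_cancel_left₀ _ (by positivity)]
    linarith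
  rw [div_le_div_iff_of_pos_right (by positivity), h3] at h4
  refine le_of_mul_le_mul_left ?_ hl
  linarith

/-- A nonnegative real `D` with `(2 - l) * D ^ 2 ≤ 2 * C * D` for all `l ∈ (0, 1]` is at most
`C`. -/
theorem le_of_forall_sq_le_mul_add {C D : ℝ} (hC : 0 ≤ C)
    (h : ∀ l : ℝ, 0 < l → l ≤ 1 → 2 * D ^ 2 ≤ 2 * C * D + l * D ^ 2) : D ≤ C := by
  by_contra! hlt
  have hD : 0 < D := hC.trans_lt hlt
  have h1 := h ((D - C) / D) (div_pos (sub_pos.2 hlt) hD) ((div_le_one hD).2 (by linarith))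
  rw [show (D - C) / D * D ^ 2 = (D - C) * D by field_simp] at h1
  nlinarith [mul_pos hD (sub_pos.2 hlt)]

theorem stmt5 {n : ℕ}
    (S : Set (EuclideanSpace ℝ (Fin n))) (hSne : S.Nonempty) (hSclosed : IsClosed S)
    (r : EuclideanSpace ℝ (Fin n) → ℝ) (hrconv : ConvexOn ℝ S r)
    (Lr : ℝ) (hLr : 0 ≤ Lr)
    (hrlip : ∀ z ∈ S, ∀ w ∈ S, |r z - r w| ≤ Lr * ‖z - w‖)
    (prox : ℝ → EuclideanSpace ℝ (Fin n) → EuclideanSpace ℝ (Fin n))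
    (hprox_mem : ∀ t : ℝ, 0 < t → ∀ z, prox t z ∈ S)
    (hprox_min : ∀ t : ℝ, 0 < t → ∀ z, ∀ y ∈ S,
      r (prox t z) + ‖prox t z - z‖ ^ 2 / (2 * t) ≤ r y + ‖y - z‖ ^ 2 / (2 * t))
    (hprox_uniq : ∀ t : ℝ, 0 < t → ∀ z, ∀ y ∈ S,
      (∀ y' ∈ S, r y + ‖y - z‖ ^ 2 / (2 * t) ≤ r y' + ‖y' - z‖ ^ 2 / (2 * t)) → y = prox t z)
    (f : EuclideanSpace ℝ (Fin n) → ℝ) (x : EuclideanSpace ℝ (Fin n)) (hx : x ∈ S) (gx : EuclideanSpace ℝ (Fin n))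
    (hf : HasGradientAt f gx x)
    (Bg : ℝ) (hBg : ‖gx‖ ≤ Bg)
    (t : ℝ) (ht : 0 < t) :
    ‖x - prox t (x - t • gx)‖ ≤ t * (Bg + Lr) := by
  have hC : 0 ≤ t * (Bg + Lr) :=
    mul_nonneg ht.le (add_nonneg ((norm_nonneg _).trans hBg) hLr)
  refine le_of_forall_sq_le_mul_add hC fun l hl hl1 => ?_
  have hp := hprox_mem t ht (x - t • gx)
  have h := inner_sub_le_of_prox_min hrconv.1 ht hp hx
    (fun y hy => (le_abs_self _).trans (hrlip y hy _ hp)) (hprox_min t ht _) hl hl1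
  generalize prox t (x - t • gx) = p at h ⊢
  rw [show x - t • gx - p = (x - p) - t • gx by abel, inner_sub_left, inner_smul_left,
    real_inner_self_eq_norm_sq] at h
  have hg : ⟪gx, x - p⟫ ≤ Bg * ‖x - p‖ :=
    (real_inner_le_norm _ _).trans (by gcongr)
  have htg := mul_le_mul_of_nonneg_left hg ht.le
  simp only [conj_trivial] at h
  linarith
end

section
/- Let r : ℝ^n → ℝ ∪ {+∞} be proper, closed and convex, let z ∈ ℝ^n, and let η₁ ≥ η₂ > 0. Then ‖prox_{η₁ r}(z) − prox_{η₂ r}(z)‖ ≤ (η₁/η₂ − 1) ‖prox_{η₂ r}(z) − z‖. -/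
open MeasureTheory Filter
open scoped RealInnerProductSpace

/-- The variational inequality of a proximal point: if `p` minimizes
`r y + ‖y - z‖ ^ 2 / (2 * t)` over `S`, then `(z - p) / t` is a subgradient of `r` at `p`. -/
theorem ConvexOn.subgradient_of_prox {E : Type*} [NormedAddCommGroup E] [InnerProductSpace ℝ E]
    {S : Set E} {r : E → ℝ} (hr : ConvexOn ℝ S r) {t : ℝ} {z p : E} (hp : p ∈ S)
    (hmin : ∀ y ∈ S, r p + ‖p - z‖ ^ 2 / (2 * t) ≤ r y + ‖y - z‖ ^ 2 / (2 * t))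
    (ht : 0 < t) {y : E} (hy : y ∈ S) :
    r p + ⟪z - p, y - p⟫ / t ≤ r y := by
  set A := r y - r p - ⟪z - p, y - p⟫ / t with hA
  set B := ‖y - p‖ ^ 2 / (2 * t) with hB
  have hB0 : 0 ≤ B := by positivity
  have key : ∀ s : ℝ, 0 < s → s ≤ 1 → 0 ≤ A + s * B := by
    intro s hs hs1
    have hmem := hr.1 hp hy (sub_nonneg.2 hs1) hs.le (by ring)
    have hconv := hr.2 hp hy (sub_nonneg.2 hs1) hs.le (by ring)
    have hle := hmin _ hmem
    have hvec : (1 - s) • p + s • y - z = (p - z) + s • (y - p) := by module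
    have hnorm : ‖(1 - s) • p + s • y - z‖ ^ 2
        = ‖p - z‖ ^ 2 - 2 * s * ⟪z - p, y - p⟫ + s ^ 2 * ‖y - p‖ ^ 2 := by
      rw [hvec, norm_add_sq_real, inner_smul_right, norm_smul, mul_pow, Real.norm_eq_abs, sq_abs,
        ← neg_sub z p, inner_neg_left, norm_neg]
      ring
    rw [hnorm] at hle
    simp only [smul_eq_mul] at hconv
    have hsplit : (‖p - z‖ ^ 2 - 2 * s * ⟪z - p, y - p⟫ + s ^ 2 * ‖y - p‖ ^ 2) / (2 * t)
        = ‖p - z‖ ^ 2 / (2 * t) - s * (⟪z - p, y - p⟫ / t) + s * (s * B) := by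
      rw [hB]
      field_simp
    rw [hsplit] at hle
    refine nonneg_of_mul_nonneg_right ?_ hs
    rw [hA]
    linarith
  suffices 0 ≤ A by linarith
  by_contra! hneg
  have hpos : 0 < B - A := by linarith
  have h := key (-A / (B - A)) (div_pos (neg_pos.2 hneg) hpos) ((div_le_one hpos).2 (by linarith))
  have heq : A + -A / (B - A) * B = -(A ^ 2 / (B - A)) := by
    field_simp
    ring
  have : 0 < A ^ 2 / (B - A) := div_pos (sq_pos_of_neg hneg) hpos
  linarith

theorem stmt6 {n : ℕ}
    (S : Set (EuclideanSpace ℝ (Fin n))) (hSne : S.Nonempty) (hSclosed : IsClosed S)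
    (r : EuclideanSpace ℝ (Fin n) → ℝ) (hrconv : ConvexOn ℝ S r)
    (prox : ℝ → EuclideanSpace ℝ (Fin n) → EuclideanSpace ℝ (Fin n))
    (hprox_mem : ∀ t : ℝ, 0 < t → ∀ z, prox t z ∈ S)
    (hprox_min : ∀ t : ℝ, 0 < t → ∀ z, ∀ y ∈ S,
      r (prox t z) + ‖prox t z - z‖ ^ 2 / (2 * t) ≤ r y + ‖y - z‖ ^ 2 / (2 * t))
    (hprox_uniq : ∀ t : ℝ, 0 < t → ∀ z, ∀ y ∈ S,
      (∀ y' ∈ S, r y + ‖y - z‖ ^ 2 / (2 * t) ≤ r y' + ‖y' - z‖ ^ 2 / (2 * t)) → y = prox t z)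
    (z : EuclideanSpace ℝ (Fin n)) (η₁ η₂ : ℝ) (hη₂ : 0 < η₂) (hη : η₂ ≤ η₁) :
    ‖prox η₁ z - prox η₂ z‖ ≤ (η₁ / η₂ - 1) * ‖prox η₂ z - z‖ := by
  have hη₁ : 0 < η₁ := hη₂.trans_le hη
  have h₁ := hrconv.subgradient_of_prox (hprox_mem η₁ hη₁ z) (hprox_min η₁ hη₁ z) hη₁
    (hprox_mem η₂ hη₂ z)
  have h₂ := hrconv.subgradient_of_prox (hprox_mem η₂ hη₂ z) (hprox_min η₂ hη₂ z) hη₂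
    (hprox_mem η₁ hη₁ z)
  set p := prox η₁ z
  set q := prox η₂ z
  have hinner : ⟪z - p, q - p⟫ = ‖p - q‖ ^ 2 + ⟪q - z, p - q⟫ := by
    rw [show z - p = -((p - q) + (q - z)) by abel, show q - p = -(p - q) by abel,
      inner_neg_neg, inner_add_left, real_inner_self_eq_norm_sq]
  have hinner' : ⟪z - q, p - q⟫ = -⟪q - z, p - q⟫ := by
    rw [← inner_neg_left, neg_sub]
  rw [hinner] at h₁
  rw [hinner'] at h₂
  have hratio : 0 ≤ η₁ / η₂ - 1 := sub_nonneg.2 ((one_le_div hη₂).2 hη)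
  have hsum : (‖p - q‖ ^ 2 + ⟪q - z, p - q⟫) / η₁ ≤ ⟪q - z, p - q⟫ / η₂ := by
    rw [neg_div] at h₂
    linarith
  have hsq : ‖p - q‖ ^ 2 ≤ (η₁ / η₂ - 1) * ⟪q - z, p - q⟫ := by
    rw [div_le_iff₀ hη₁] at hsum
    linear_combination hsum
  have hcs := mul_le_mul_of_nonneg_left (real_inner_le_norm (q - z) (p - q)) hratio
  rcases (norm_nonneg (p - q)).eq_or_lt with h0 | h0
  · rw [← h0]
    positivity
  · refine le_of_mul_le_mul_right ?_ h0
    linarith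
end

section
/- Let r : ℝ^n → ℝ ∪ {+∞} be proper, closed, convex, and L_r-Lipschitz continuous on dom(r); let f be differentiable at x ∈ dom(r) with ‖∇f(x)‖ ≤ B_g. Let 0 < η_min ≤ η_max and suppose η₁, η₂ ∈ [η_min, η_max]. Then ‖prox_{η₁ r}(x − η₁ ∇f(x)) − prox_{η₂ r}(x − η₂ ∇f(x))‖ ≤ (η_max − η_min)(L_r + 3 B_g). -/
open MeasureTheory Filter
open scoped RealInnerProductSpace

/-- A minimizer `p` over `S` of `r + ‖· - z‖ ^ 2 / (2 * t)` has `(z - p) / t` as a subgradient. -/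
lemma ConvexOn.add_inner_div_le_of_forall_prox_le {E : Type*} [NormedAddCommGroup E]
    [InnerProductSpace ℝ E] {S : Set E} {r : E → ℝ} (hr : ConvexOn ℝ S r) {t : ℝ} (ht : 0 < t)
    {z p : E} (hp : p ∈ S)
    (hmin : ∀ y ∈ S, r p + ‖p - z‖ ^ 2 / (2 * t) ≤ r y + ‖y - z‖ ^ 2 / (2 * t))
    {y : E} (hy : y ∈ S) : r p + ⟪z - p, y - p⟫ / t ≤ r y := by
  set a := r y - r p - ⟪z - p, y - p⟫ / t with ha
  set b := ‖y - p‖ ^ 2 / (2 * t) with hb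
  have hb0 : 0 ≤ b := by positivity
  have key : ∀ s : ℝ, 0 < s → s ≤ 1 → 0 ≤ a + s * b := by
    intro s hs hs1
    have hmem := hr.1 hp hy (sub_nonneg.2 hs1) hs.le (by ring)
    have hconv := hr.2 hp hy (sub_nonneg.2 hs1) hs.le (by ring)
    have hle := hmin _ hmem
    have hnorm : ‖(1 - s) • p + s • y - z‖ ^ 2
        = ‖p - z‖ ^ 2 - 2 * s * ⟪z - p, y - p⟫ + s ^ 2 * ‖y - p‖ ^ 2 := by
      have hdecomp : (1 - s) • p + s • y - z = s • (y - p) - (z - p) := by module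
      rw [hdecomp, norm_sub_sq_real, norm_smul, real_inner_smul_left, real_inner_comm,
        norm_sub_rev p z, Real.norm_of_nonneg hs.le]
      ring
    rw [hnorm] at hle
    simp only [smul_eq_mul] at hconv
    have hsplit : (‖p - z‖ ^ 2 - 2 * s * ⟪z - p, y - p⟫ + s ^ 2 * ‖y - p‖ ^ 2) / (2 * t)
        = ‖p - z‖ ^ 2 / (2 * t) - s * (⟪z - p, y - p⟫ / t) + s * (s * b) := by
      rw [hb]
      field_simp
    have hmul : 0 ≤ s * (a + s * b) := by
      rw [ha]
      linarith
    exact nonneg_of_mul_nonneg_right hmul hs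
  have ha0 : 0 ≤ a := by
    by_contra! hneg
    have hpos : 0 < b - a := by linarith
    have h := key (-a / (b - a)) (div_pos (by linarith) hpos) ((div_le_one hpos).2 (by linarith))
    have heq : a + -a / (b - a) * b = -(a ^ 2 / (b - a)) := by
      field_simp
      ring
    have hlt : 0 < a ^ 2 / (b - a) := div_pos (sq_pos_of_neg hneg) hpos
    linarith
  linarith

theorem stmt7 {n : ℕ}
    (S : Set (EuclideanSpace ℝ (Fin n))) (hSne : S.Nonempty) (hSclosed : IsClosed S)
    (r : EuclideanSpace ℝ (Fin n) → ℝ) (hrconv : ConvexOn ℝ S r)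
    (Lr : ℝ) (hLr : 0 ≤ Lr)
    (hrlip : ∀ z ∈ S, ∀ w ∈ S, |r z - r w| ≤ Lr * ‖z - w‖)
    (prox : ℝ → EuclideanSpace ℝ (Fin n) → EuclideanSpace ℝ (Fin n))
    (hprox_mem : ∀ t : ℝ, 0 < t → ∀ z, prox t z ∈ S)
    (hprox_min : ∀ t : ℝ, 0 < t → ∀ z, ∀ y ∈ S,
      r (prox t z) + ‖prox t z - z‖ ^ 2 / (2 * t) ≤ r y + ‖y - z‖ ^ 2 / (2 * t))
    (hprox_uniq : ∀ t : ℝ, 0 < t → ∀ z, ∀ y ∈ S,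
      (∀ y' ∈ S, r y + ‖y - z‖ ^ 2 / (2 * t) ≤ r y' + ‖y' - z‖ ^ 2 / (2 * t)) → y = prox t z)
    (f : EuclideanSpace ℝ (Fin n) → ℝ) (x : EuclideanSpace ℝ (Fin n)) (hx : x ∈ S) (gx : EuclideanSpace ℝ (Fin n))
    (hf : HasGradientAt f gx x)
    (Bg : ℝ) (hBg : ‖gx‖ ≤ Bg)
    (ηmin ηmax η₁ η₂ : ℝ) (hηmin : 0 < ηmin) (hηminmax : ηmin ≤ ηmax)
    (hη₁ : η₁ ∈ Set.Icc ηmin ηmax) (hη₂ : η₂ ∈ Set.Icc ηmin ηmax) :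
    ‖prox η₁ (x - η₁ • gx) - prox η₂ (x - η₂ • gx)‖ ≤ (ηmax - ηmin) * (Lr + 3 * Bg) := by
  have hη₁0 : 0 < η₁ := hηmin.trans_le hη₁.1
  have hη₂0 : 0 < η₂ := hηmin.trans_le hη₂.1
  have hBg0 : 0 ≤ Bg := (norm_nonneg gx).trans hBg
  set p₁ := prox η₁ (x - η₁ • gx) with hp₁
  set p₂ := prox η₂ (x - η₂ • gx) with hp₂
  have hm₁ : p₁ ∈ S := hprox_mem η₁ hη₁0 _
  have hm₂ : p₂ ∈ S := hprox_mem η₂ hη₂0 _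
  have hsub : ∀ η : ℝ, 0 < η → ∀ y ∈ S,
      r (prox η (x - η • gx)) + ⟪x - prox η (x - η • gx), y - prox η (x - η • gx)⟫ / η
        - ⟪gx, y - prox η (x - η • gx)⟫ ≤ r y := by
    intro η hη y hy
    have h := hrconv.add_inner_div_le_of_forall_prox_le hη (hprox_mem η hη (x - η • gx))
      (hprox_min η hη _) hy
    rw [sub_right_comm, inner_sub_left, real_inner_smul_left, sub_div,
      mul_div_cancel_left₀ _ hη.ne'] at h
    linarith
  have h₁ := hsub η₁ hη₁0 p₂ hm₂
  have h₂ := hsub η₂ hη₂0 p₁ hm₁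
  have h₃ := hsub η₂ hη₂0 x hx
  rw [← hp₁] at h₁
  rw [← hp₂] at h₂ h₃
  have hstep : ‖x - p₂‖ ≤ η₂ * (Lr + Bg) := by
    have hl := (le_abs_self _).trans (hrlip x hx p₂ hm₂)
    have hg : ⟪gx, x - p₂⟫ ≤ Bg * ‖x - p₂‖ :=
      (real_inner_le_norm _ _).trans (by gcongr)
    rw [real_inner_self_eq_norm_sq] at h₃
    have h : ‖x - p₂‖ ^ 2 / η₂ ≤ (Lr + Bg) * ‖x - p₂‖ := by linarith
    rw [div_le_iff₀ hη₂0] at h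
    rcases (norm_nonneg (x - p₂)).eq_or_lt with h0 | h0
    · rw [← h0]
      positivity
    · exact le_of_mul_le_mul_right (by linarith) h0
  have hmono : ‖p₁ - p₂‖ ^ 2 * η₂ ≤ (η₂ - η₁) * ⟪x - p₂, p₁ - p₂⟫ := by
    have hg : ⟪gx, p₂ - p₁⟫ = -⟪gx, p₁ - p₂⟫ := by rw [← inner_neg_right, neg_sub]
    have hu : ⟪x - p₁, p₂ - p₁⟫ = ‖p₁ - p₂‖ ^ 2 - ⟪x - p₂, p₁ - p₂⟫ := by
      rw [← real_inner_self_eq_norm_sq, ← inner_sub_left, ← neg_sub p₁ p₂, inner_neg_right,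
        ← inner_neg_left]
      congr 1
      abel
    rw [hu, hg] at h₁
    have h : (‖p₁ - p₂‖ ^ 2 - ⟪x - p₂, p₁ - p₂⟫) / η₁ + ⟪x - p₂, p₁ - p₂⟫ / η₂ ≤ 0 := by
      linarith
    rw [div_add_div _ _ hη₁0.ne' hη₂0.ne', div_le_iff₀ (by positivity)] at h
    linarith
  have hbound : (η₂ - η₁) * ⟪x - p₂, p₁ - p₂⟫
      ≤ (ηmax - ηmin) * (η₂ * (Lr + Bg) * ‖p₁ - p₂‖) := by
    refine (le_abs_self _).trans ?_
    rw [abs_mul]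
    have hη : |η₂ - η₁| ≤ ηmax - ηmin :=
      abs_le.2 ⟨by linarith [hη₁.2, hη₂.1], by linarith [hη₁.1, hη₂.2]⟩
    have hinner : |⟪x - p₂, p₁ - p₂⟫| ≤ η₂ * (Lr + Bg) * ‖p₁ - p₂‖ :=
      (abs_real_inner_le_norm _ _).trans (by gcongr)
    exact mul_le_mul hη hinner (abs_nonneg _) (by linarith)
  have hd : 0 ≤ ηmax - ηmin := sub_nonneg.2 hηminmax
  have hmain : ‖p₁ - p₂‖ ≤ (ηmax - ηmin) * (Lr + Bg) := by
    rcases (norm_nonneg (p₁ - p₂)).eq_or_lt with h0 | h0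
    · rw [← h0]
      positivity
    · refine le_of_mul_le_mul_right ?_ (mul_pos h0 hη₂0)
      linarith
  exact hmain.trans (mul_le_mul_of_nonneg_left (by linarith) hd)
end

section
/- Under the standing stochastic setup, for every k ≥ 0, with the auxiliary iterate x̄_{k+1} ≜ prox_{t_{k−1} r}(x_k − t_{k−1} ∇f(x_k)), the expected gap between the true and sampled objective at the next iterate satisfies E[φ(x_{k+1}) − (f̃_k(x_{k+1}) + r(x_{k+1}))] ≤ (1/(2L) + 3 L s²) σ²/N_k + 3 L (s − c)² (L_r + 3 B_g)² ℙ(t_k ≠ t_{k−1}). -/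
open MeasureTheory Filter
open scoped RealInnerProductSpace

/-- Descent lemma on a convex set. -/
theorem le_linearization_add_sq {E : Type*} [NormedAddCommGroup E] [InnerProductSpace ℝ E]
    [CompleteSpace E] {S : Set E} (hS : Convex ℝ S) {f : E → ℝ} {g : E → E} {L : ℝ}
    (hf : ∀ z ∈ S, HasGradientAt f (g z) z)
    (hg : ∀ z ∈ S, ∀ w ∈ S, ‖g z - g w‖ ≤ L * ‖z - w‖) {x y : E} (hx : x ∈ S) (hy : y ∈ S) :
    f y ≤ f x + ⟪g x, y - x⟫ + L / 2 * ‖y - x‖ ^ 2 := by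
  set d := y - x with hd
  have hmem : ∀ a ∈ Set.Icc (0 : ℝ) 1, x + a • d ∈ S := fun a ha =>
    hS.add_smul_sub_mem hx hy ha
  have hderiv : ∀ a ∈ Set.Icc (0 : ℝ) 1,
      HasDerivAt (fun b : ℝ => f (x + b • d) - b * ⟪g x, d⟫ - L / 2 * ‖d‖ ^ 2 * b ^ 2)
        (⟪g (x + a • d), d⟫ - ⟪g x, d⟫ - L * ‖d‖ ^ 2 * a) a := by
    intro a ha
    have hline : HasDerivAt (fun b : ℝ => x + b • d) d a := by
      simpa using ((hasDerivAt_id a).smul_const d).const_add x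
    have hcomp := (hf _ (hmem a ha)).hasFDerivAt.comp_hasDerivAt a hline
    have hlin : HasDerivAt (fun b : ℝ => b * ⟪g x, d⟫) ⟪g x, d⟫ a := by
      simpa using (hasDerivAt_id a).mul_const ⟪g x, d⟫
    have hquad : HasDerivAt (fun b : ℝ => L / 2 * ‖d‖ ^ 2 * b ^ 2) (L * ‖d‖ ^ 2 * a) a := by
      refine ((hasDerivAt_pow 2 a).const_mul (L / 2 * ‖d‖ ^ 2)).congr_deriv ?_
      norm_num
      ring
    exact (hcomp.sub hlin).sub hquad
  have hanti : AntitoneOn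
      (fun b : ℝ => f (x + b • d) - b * ⟪g x, d⟫ - L / 2 * ‖d‖ ^ 2 * b ^ 2)
      (Set.Icc 0 1) := by
    refine antitoneOn_of_deriv_nonpos (convex_Icc 0 1)
      (fun a ha => (hderiv a ha).continuousAt.continuousWithinAt)
      (fun a ha => (hderiv a (interior_subset ha)).differentiableAt.differentiableWithinAt) ?_
    intro a ha
    have ha' := interior_subset ha
    rw [(hderiv a ha').deriv, ← inner_sub_left]
    have h1 := real_inner_le_norm (g (x + a • d) - g x) d
    have h2 := hg _ (hmem a ha') x hx
    rw [add_sub_cancel_left, norm_smul, Real.norm_of_nonneg ha'.1] at h2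
    nlinarith [mul_le_mul_of_nonneg_right h2 (norm_nonneg d)]
  have h := hanti (Set.left_mem_Icc.2 zero_le_one) (Set.right_mem_Icc.2 zero_le_one) zero_le_one
  simp only [one_smul, zero_smul, add_zero, one_mul, zero_mul, hd, add_sub_cancel] at h
  rw [hd]
  linarith

/-- A minimizer of the proximal objective `r y + ‖y - z‖ ^ 2 / (2 * t)` over a set on which `r` is
convex satisfies the subgradient inequality. -/
theorem subgradient_of_isMinOn_prox {E : Type*} [NormedAddCommGroup E] [InnerProductSpace ℝ E]
    {S : Set E} {r : E → ℝ} (hr : ConvexOn ℝ S r) {t : ℝ} (ht : 0 < t) {z p : E} (hp : p ∈ S)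
    (hmin : ∀ y ∈ S, r p + ‖p - z‖ ^ 2 / (2 * t) ≤ r y + ‖y - z‖ ^ 2 / (2 * t))
    {y : E} (hy : y ∈ S) : ⟪z - p, y - p⟫ ≤ t * (r y - r p) := by
  have key : ∀ a ∈ Set.Ioc (0 : ℝ) 1,
      ⟪z - p, y - p⟫ - t * (r y - r p) ≤ a * (‖y - p‖ ^ 2 / 2) := by
    intro a ha
    have hmem : p + a • (y - p) ∈ S := hr.1.add_smul_sub_mem hp hy ⟨ha.1.le, ha.2⟩
    have h1 := hmin _ hmem
    have h2 : r (p + a • (y - p)) ≤ (1 - a) * r p + a * r y := by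
      have h := hr.2 hp hy (sub_nonneg.2 ha.2) ha.1.le (sub_add_cancel 1 a)
      have e : (1 - a) • p + a • y = p + a • (y - p) := by module
      rwa [e, smul_eq_mul, smul_eq_mul] at h
    have h3 : ‖p + a • (y - p) - z‖ ^ 2
        = ‖p - z‖ ^ 2 - 2 * a * ⟪z - p, y - p⟫ + a ^ 2 * ‖y - p‖ ^ 2 := by
      have e : p + a • (y - p) - z = (p - z) + a • (y - p) := by module
      rw [e, norm_add_sq_real, inner_smul_right, norm_smul, mul_pow, Real.norm_eq_abs, sq_abs,
        ← neg_sub z p, inner_neg_left, norm_neg]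
      ring
    rw [h3] at h1
    have h4 : ‖p - z‖ ^ 2 ≤ 2 * t * (a * (r y - r p))
        + (‖p - z‖ ^ 2 - 2 * a * ⟪z - p, y - p⟫ + a ^ 2 * ‖y - p‖ ^ 2) := by
      have h5 : ‖p - z‖ ^ 2 / (2 * t) ≤ a * (r y - r p)
          + (‖p - z‖ ^ 2 - 2 * a * ⟪z - p, y - p⟫ + a ^ 2 * ‖y - p‖ ^ 2) / (2 * t) := by
        linarith
      have h2t : 0 < 2 * t := by positivity
      have h6 := mul_le_mul_of_nonneg_left h5 h2t.le
      rwa [mul_add, mul_div_cancel₀ _ h2t.ne', mul_div_cancel₀ _ h2t.ne'] at h6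
    have h7 : a * (⟪z - p, y - p⟫ - t * (r y - r p)) ≤ a * (a * (‖y - p‖ ^ 2 / 2)) := by
      nlinarith
    exact le_of_mul_le_mul_left h7 ha.1
  have hlim : Tendsto (fun a : ℝ => a * (‖y - p‖ ^ 2 / 2)) (nhdsWithin 0 (Set.Ioi 0))
      (nhds 0) := by
    have h : Continuous fun a : ℝ => a * (‖y - p‖ ^ 2 / 2) := by fun_prop
    simpa using (h.tendsto 0).mono_left nhdsWithin_le_nhds
  have h := ge_of_tendsto hlim
    (Filter.mem_of_superset (Ioc_mem_nhdsGT (zero_lt_one' ℝ)) key)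
  linarith

/-- `P` is a proximal map of `r` restricted to `S`. -/
structure IsProxMap {E : Type*} [NormedAddCommGroup E] (S : Set E) (r : E → ℝ)
    (P : ℝ → E → E) : Prop where
  mem : ∀ t : ℝ, 0 < t → ∀ z, P t z ∈ S
  le : ∀ t : ℝ, 0 < t → ∀ z, ∀ y ∈ S,
    r (P t z) + ‖P t z - z‖ ^ 2 / (2 * t) ≤ r y + ‖y - z‖ ^ 2 / (2 * t)

namespace IsProxMap

variable {E : Type*} [NormedAddCommGroup E] [InnerProductSpace ℝ E] {S : Set E} {r : E → ℝ}
  {P : ℝ → E → E}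

theorem subgradient (hP : IsProxMap S r P) (hr : ConvexOn ℝ S r) {t : ℝ} (ht : 0 < t) (z : E)
    {y : E} (hy : y ∈ S) : ⟪z - P t z, y - P t z⟫ ≤ t * (r y - r (P t z)) :=
  subgradient_of_isMinOn_prox hr ht (hP.mem t ht z) (hP.le t ht z) hy

theorem nonexpansive (hP : IsProxMap S r P) (hr : ConvexOn ℝ S r) {t : ℝ} (ht : 0 < t)
    (z w : E) : ‖P t z - P t w‖ ≤ ‖z - w‖ := by
  have h1 := hP.subgradient hr ht z (hP.mem t ht w)
  have h2 := hP.subgradient hr ht w (hP.mem t ht z)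
  set p := P t z
  set q := P t w
  have h3 : ⟪z - p, q - p⟫ + ⟪w - q, p - q⟫ = ‖p - q‖ ^ 2 - ⟪z - w, p - q⟫ := by
    have e : ⟪z - p, q - p⟫ = -⟪z - p, p - q⟫ := by rw [← inner_neg_right, neg_sub]
    rw [e, ← real_inner_self_eq_norm_sq]
    simp only [inner_sub_left]
    ring
  have h4 := real_inner_le_norm (z - w) (p - q)
  by_contra! h
  nlinarith [norm_nonneg (z - w)]

/-- Dependence of a proximal gradient step on the step size. -/
theorem norm_step_sub_step_le (hP : IsProxMap S r P) (hr : ConvexOn ℝ S r) {t τ : ℝ}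
    (ht : 0 < t) (hτ : 0 < τ) (x v : E) :
    ‖P t (x - t • v) - P τ (x - τ • v)‖ ≤ |t - τ| / τ * ‖x - P τ (x - τ • v)‖ := by
  have h1 := hP.subgradient hr ht (x - t • v) (hP.mem τ hτ (x - τ • v))
  have h2 := hP.subgradient hr hτ (x - τ • v) (hP.mem t ht (x - t • v))
  set p := P t (x - t • v)
  set q := P τ (x - τ • v)
  have h3 : τ * ⟪x - t • v - p, q - p⟫ + t * ⟪x - τ • v - q, p - q⟫
      = τ * ‖p - q‖ ^ 2 + (τ - t) * ⟪x - q, q - p⟫ := by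
    have e1 : x - t • v - p = (x - q) - t • v - (p - q) := by abel
    have e2 : q - p = -(p - q) := by abel
    have e3 : x - τ • v - q = (x - q) - τ • v := by abel
    rw [e1, e2, e3, ← real_inner_self_eq_norm_sq]
    simp only [inner_sub_left, inner_neg_right, real_inner_smul_left]
    ring
  have h4 : τ * ‖p - q‖ ^ 2 ≤ |t - τ| * (‖x - q‖ * ‖p - q‖) := by
    have h5 : (t - τ) * ⟪x - q, q - p⟫ ≤ |t - τ| * (‖x - q‖ * ‖p - q‖) := by
      refine (le_abs_self _).trans ?_
      rw [abs_mul, norm_sub_rev p q]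
      exact mul_le_mul_of_nonneg_left (abs_real_inner_le_norm _ _) (abs_nonneg _)
    nlinarith [mul_le_mul_of_nonneg_left h1 hτ.le, mul_le_mul_of_nonneg_left h2 ht.le]
  rw [div_mul_eq_mul_div, le_div_iff₀ hτ]
  rcases (norm_nonneg (p - q)).eq_or_lt with h0 | h0
  · rw [← h0]
    simp only [zero_mul]
    positivity
  · refine le_of_mul_le_mul_right ?_ h0
    nlinarith

theorem norm_sub_step_le (hP : IsProxMap S r P) (hr : ConvexOn ℝ S r) {K : ℝ}
    (hrlip : ∀ z ∈ S, ∀ w ∈ S, |r z - r w| ≤ K * ‖z - w‖) {t : ℝ} (ht : 0 < t) {x : E}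
    (hx : x ∈ S) (hK : 0 ≤ K) (v : E) : ‖x - P t (x - t • v)‖ ≤ t * (K + ‖v‖) := by
  have h1 := hP.subgradient hr ht (x - t • v) hx
  have h2 := (le_abs_self _).trans (hrlip x hx _ (hP.mem t ht (x - t • v)))
  set q := P t (x - t • v)
  have e : x - t • v - q = (x - q) - t • v := by abel
  rw [e, inner_sub_left, real_inner_smul_left, real_inner_self_eq_norm_sq] at h1
  have h3 := real_inner_le_norm v (x - q)
  by_contra! h
  have h0 : 0 < ‖x - q‖ := lt_of_le_of_lt (by positivity) h
  nlinarith [mul_lt_mul_of_pos_right h h0]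

theorem continuousOn (hP : IsProxMap S r P) (hr : ConvexOn ℝ S r) :
    ContinuousOn (fun a : ℝ × E => P a.1 a.2) (Set.Ioi 0 ×ˢ Set.univ) := by
  rintro ⟨τ, w⟩ ⟨hτ : 0 < τ, -⟩
  rw [ContinuousWithinAt, tendsto_iff_norm_sub_tendsto_zero]
  have hlim : Tendsto (fun a : ℝ × E => ‖a.2 - w‖ + |a.1 - τ| / τ * ‖w - P τ w‖)
      (nhdsWithin (τ, w) (Set.Ioi 0 ×ˢ Set.univ)) (nhds 0) := by
    have h : Continuous fun a : ℝ × E => ‖a.2 - w‖ + |a.1 - τ| / τ * ‖w - P τ w‖ := by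
      fun_prop
    simpa using (h.tendsto (τ, w)).mono_left nhdsWithin_le_nhds
  refine squeeze_zero' (Eventually.of_forall fun _ => norm_nonneg _) ?_ hlim
  filter_upwards [self_mem_nhdsWithin] with a ha
  have h1 := hP.nonexpansive hr ha.1 a.2 w
  have h2 := hP.norm_step_sub_step_le hr ha.1 hτ w 0
  simp only [smul_zero, sub_zero] at h2
  exact (norm_sub_le_norm_sub_add_norm_sub _ (P a.1 w) _).trans (add_le_add h1 h2)

end IsProxMap

/-- Variation of the difference of two functions with `L`-Lipschitz gradients. -/
theorem sub_le_sub_add_norm_gradient_sub_sq {E : Type*} [NormedAddCommGroup E]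
    [InnerProductSpace ℝ E] [CompleteSpace E] {S : Set E} (hS : Convex ℝ S) {f F : E → ℝ}
    {g G : E → E} {L : ℝ} (hL : 0 < L)
    (hf : ∀ z ∈ S, HasGradientAt f (g z) z)
    (hg : ∀ z ∈ S, ∀ w ∈ S, ‖g z - g w‖ ≤ L * ‖z - w‖)
    (hF : ∀ z ∈ S, HasGradientAt F (G z) z)
    (hG : ∀ z ∈ S, ∀ w ∈ S, ‖G z - G w‖ ≤ L * ‖z - w‖) {x y : E} (hx : x ∈ S) (hy : y ∈ S) :
    f y - F y ≤ f x - F x + 1 / (2 * L) * ‖G x - g x‖ ^ 2 + 3 * L / 2 * ‖y - x‖ ^ 2 := by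
  have h1 := le_linearization_add_sq hS hf hg hx hy
  have hFneg : ∀ z ∈ S, HasGradientAt (fun w => -F w) (-G z) z := by
    intro z hz
    rw [hasGradientAt_iff_hasFDerivAt, map_neg]
    exact (hF z hz).hasFDerivAt.neg
  have h2 := le_linearization_add_sq (g := fun z => -G z) hS hFneg
    (fun z hz w hw => by rw [neg_sub_neg, norm_sub_rev]; exact hG z hz w hw) hx hy
  have h3 : -⟪G x - g x, y - x⟫ ≤ 1 / (2 * L) * ‖G x - g x‖ ^ 2 + L / 2 * ‖y - x‖ ^ 2 := by
    have h := (neg_le_abs _).trans (abs_real_inner_le_norm (G x - g x) (y - x))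
    refine h.trans ?_
    have e : 1 / (2 * L) * ‖G x - g x‖ ^ 2 + L / 2 * ‖y - x‖ ^ 2
        - ‖G x - g x‖ * ‖y - x‖ = 1 / (2 * L) * (‖G x - g x‖ - L * ‖y - x‖) ^ 2 := by
      field_simp
      ring
    have h0 : 0 ≤ 1 / (2 * L) * (‖G x - g x‖ - L * ‖y - x‖) ^ 2 := by positivity
    linarith
  rw [inner_sub_left] at h3
  rw [inner_neg_left] at h2
  linarith

/-- Distance between an inexact proximal gradient step and an exact one with another step size. -/
theorem IsProxMap.norm_inexact_step_sub_step_le {E : Type*} [NormedAddCommGroup E]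
    [InnerProductSpace ℝ E] {S : Set E} {r : E → ℝ} {P : ℝ → E → E} (hP : IsProxMap S r P)
    (hr : ConvexOn ℝ S r) {K : ℝ} (hK : 0 ≤ K)
    (hrlip : ∀ z ∈ S, ∀ w ∈ S, |r z - r w| ≤ K * ‖z - w‖) {t τ : ℝ} (ht : 0 < t) (hτ : 0 < τ)
    {x : E} (hx : x ∈ S) (u v : E) :
    ‖P t (x - t • u) - P τ (x - τ • v)‖ ≤ t * ‖u - v‖ + |t - τ| * (K + ‖v‖) := by
  have h1 := hP.nonexpansive hr ht (x - t • u) (x - t • v)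
  have h2 := hP.norm_step_sub_step_le hr ht hτ x v
  have h3 := hP.norm_sub_step_le hr hrlip hτ hx hK v
  have e : ‖x - t • u - (x - t • v)‖ = t * ‖u - v‖ := by
    rw [sub_sub_sub_cancel_left, ← smul_sub, norm_smul, Real.norm_of_nonneg ht.le, norm_sub_rev]
  have h4 : |t - τ| / τ * ‖x - P τ (x - τ • v)‖ ≤ |t - τ| * (K + ‖v‖) := by
    refine (mul_le_mul_of_nonneg_left h3 (by positivity)).trans_eq ?_
    field_simp
  rw [e] at h1
  exact (norm_sub_le_norm_sub_add_norm_sub _ (P t (x - t • v)) _).trans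
    (add_le_add h1 (h2.trans h4))

theorem exists_stronglyMeasurable_forall_mem_ae_eq {Ω E : Type*} {m m0 : MeasurableSpace Ω}
    {μ : Measure Ω} [TopologicalSpace E] [TopologicalSpace.PseudoMetrizableSpace E] {y : Ω → E}
    (hy : StronglyMeasurable[m] y) {A : Set E} (hA : IsClosed A) (hne : A.Nonempty)
    (hmem : ∀ᵐ ω ∂μ, y ω ∈ A) :
    ∃ y' : Ω → E, StronglyMeasurable[m] y' ∧ (∀ ω, y' ω ∈ A) ∧ y' =ᵐ[μ] y := by
  classical
  obtain ⟨a, ha⟩ := hne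
  refine ⟨fun ω => if y ω ∈ A then y ω else a, ?_, ?_, ?_⟩
  · borelize E
    exact StronglyMeasurable.ite (hy.measurable hA.measurableSet) hy stronglyMeasurable_const
  · intro ω
    dsimp only
    split_ifs with h
    exacts [h, ha]
  · filter_upwards [hmem] with ω h
    exact if_pos h

theorem IsProxMap.stronglyMeasurable_step {Ω E : Type*} {m : MeasurableSpace Ω}
    [NormedAddCommGroup E] [InnerProductSpace ℝ E] {S : Set E} {r : E → ℝ} {P : ℝ → E → E}
    (hP : IsProxMap S r P) (hr : ConvexOn ℝ S r) {g : E → E} (hg : ContinuousOn g S)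
    {τ : Ω → ℝ} (hτ : StronglyMeasurable τ) (hτpos : ∀ ω, 0 < τ ω) {x : Ω → E}
    (hx : StronglyMeasurable x) (hxS : ∀ ω, x ω ∈ S) :
    StronglyMeasurable fun ω => P (τ ω) (x ω - τ ω • g (x ω)) := by
  have hcont : ContinuousOn (fun a : ℝ × E => P a.1 (a.2 - a.1 • g a.2)) (Set.Ioi 0 ×ˢ S) := by
    have hg' : ContinuousOn (fun a : ℝ × E => g a.2) (Set.Ioi 0 ×ˢ S) :=
      hg.comp continuousOn_snd fun a ha => ha.2
    have hinner : ContinuousOn (fun a : ℝ × E => (a.1, a.2 - a.1 • g a.2)) (Set.Ioi 0 ×ˢ S) :=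
      continuousOn_fst.prodMk (continuousOn_snd.sub (continuousOn_fst.smul hg'))
    exact (hP.continuousOn hr).comp hinner fun a ha => ⟨ha.1, Set.mem_univ _⟩
  have hmem : ∀ ω, (τ ω, x ω) ∈ Set.Ioi (0 : ℝ) ×ˢ S := fun ω => ⟨hτpos ω, hxS ω⟩
  have hpair : StronglyMeasurable fun ω => (⟨(τ ω, x ω), hmem ω⟩ : ↥(Set.Ioi (0 : ℝ) ×ˢ S)) :=
    (Embedding.comp_stronglyMeasurable_iff Topology.IsEmbedding.subtypeVal).1 (hτ.prodMk hx)
  exact hcont.domRestrict.comp_stronglyMeasurable hpair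

theorem integral_le_of_condExp_le {Ω : Type*} {m m0 : MeasurableSpace Ω} {μ : Measure Ω}
    [IsProbabilityMeasure μ] (hm : m ≤ m0) {X : Ω → ℝ} {b : ℝ}
    (h : ∀ᵐ ω ∂μ, (μ[X|m]) ω ≤ b) : ∫ ω, X ω ∂μ ≤ b := by
  rw [← integral_condExp hm]
  simpa using integral_mono_ae integrable_condExp (integrable_const b) h

theorem stmt8 {n : ℕ} {Ω : Type*} {m0 : MeasurableSpace Ω} {μ : Measure Ω}
    [IsProbabilityMeasure μ] (ℱ : Filtration ℕ m0)
    (S : Set (EuclideanSpace ℝ (Fin n))) (hSne : S.Nonempty) (hSclosed : IsClosed S)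
    (r : EuclideanSpace ℝ (Fin n) → ℝ) (hrconv : ConvexOn ℝ S r)
    (Lr : ℝ) (hLr : 0 ≤ Lr)
    (hrlip : ∀ z ∈ S, ∀ w ∈ S, |r z - r w| ≤ Lr * ‖z - w‖)
    (prox : ℝ → EuclideanSpace ℝ (Fin n) → EuclideanSpace ℝ (Fin n))
    (hprox_mem : ∀ t : ℝ, 0 < t → ∀ z, prox t z ∈ S)
    (hprox_min : ∀ t : ℝ, 0 < t → ∀ z, ∀ y ∈ S,
      r (prox t z) + ‖prox t z - z‖ ^ 2 / (2 * t) ≤ r y + ‖y - z‖ ^ 2 / (2 * t))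
    (hprox_uniq : ∀ t : ℝ, 0 < t → ∀ z, ∀ y ∈ S,
      (∀ y' ∈ S, r y + ‖y - z‖ ^ 2 / (2 * t) ≤ r y' + ‖y' - z‖ ^ 2 / (2 * t)) → y = prox t z)
    (f : EuclideanSpace ℝ (Fin n) → ℝ) (g : EuclideanSpace ℝ (Fin n) → EuclideanSpace ℝ (Fin n))
    (U : Set (EuclideanSpace ℝ (Fin n))) (hU : IsOpen U) (hSU : S ⊆ U)
    (hf : ∀ z ∈ U, HasGradientAt f (g z) z)
    (L : ℝ) (hL : 0 < L)
    (hglip : ∀ z ∈ S, ∀ w ∈ S, ‖g z - g w‖ ≤ L * ‖z - w‖)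
    (Bg : ℝ) (hBg : ∀ z ∈ S, ‖g z‖ ≤ Bg)
    (φinf : ℝ) (hφinf : ∀ z ∈ S, φinf ≤ f z + r z)
    (α β s : ℝ) (hα : α ∈ Set.Ioo (0:ℝ) 1) (hβ : β ∈ Set.Ioo (0:ℝ) 1) (hs : 0 < s)
    (c : ℝ) (hc : c = min s (2 * (1 - α) * β / L))
    (σ : ℝ) (hσ : 0 < σ)
    (N : ℕ → ℕ) (hN : ∀ k, 0 < N k)
    (x : ℕ → Ω → EuclideanSpace ℝ (Fin n)) (t : ℕ → Ω → ℝ)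
    (x₀ : EuclideanSpace ℝ (Fin n)) (hx₀ : x₀ ∈ S) (hx₀det : ∀ ω, x 0 ω = x₀)
    (hxmeas : ∀ k, StronglyMeasurable[ℱ k] (x k))
    (htmeas : ∀ k, StronglyMeasurable[ℱ (k + 1)] (t k))
    (htbd : ∀ k, ∀ᵐ ω ∂μ, c ≤ t k ω ∧ t k ω ≤ s)
    (F : ℕ → Ω → EuclideanSpace ℝ (Fin n) → ℝ) (GF : ℕ → Ω → EuclideanSpace ℝ (Fin n) → EuclideanSpace ℝ (Fin n))
    (hFgrad : ∀ k, ∀ᵐ ω ∂μ, (∀ z ∈ U, HasGradientAt (F k ω) (GF k ω z) z) ∧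
      ∀ z ∈ S, ∀ w ∈ S, ‖GF k ω z - GF k ω w‖ ≤ L * ‖z - w‖)
    (horacle_f : ∀ k, ∀ y : Ω → EuclideanSpace ℝ (Fin n),
      StronglyMeasurable[ℱ k] y → (∀ ω, y ω ∈ S) →
      Integrable (fun ω => F k ω (y ω)) μ ∧
        μ[(fun ω => F k ω (y ω))|ℱ k] =ᵐ[μ] fun ω => f (y ω))
    (horacle_g : ∀ k, ∀ y : Ω → EuclideanSpace ℝ (Fin n),
      StronglyMeasurable[ℱ k] y → (∀ ω, y ω ∈ S) →
      Integrable (fun ω => GF k ω (y ω)) μ ∧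
        μ[(fun ω => GF k ω (y ω))|ℱ k] =ᵐ[μ] fun ω => g (y ω))
    (horacle_var : ∀ k, ∀ y : Ω → EuclideanSpace ℝ (Fin n),
      StronglyMeasurable[ℱ k] y → (∀ ω, y ω ∈ S) →
      Integrable (fun ω => ‖GF k ω (y ω) - g (y ω)‖ ^ 2) μ ∧
        ∀ᵐ ω ∂μ, (μ[(fun ω' => ‖GF k ω' (y ω') - g (y ω')‖ ^ 2)|ℱ k]) ω ≤ σ ^ 2 / N k)
    (hupdate : ∀ k, ∀ᵐ ω ∂μ,
      x (k + 1) ω = prox (t k ω) (x k ω - t k ω • GF k ω (x k ω)))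
    (k : ℕ)
    (hgapint : Integrable (fun ω =>
      (f (x (k + 1) ω) + r (x (k + 1) ω)) - (F k ω (x (k + 1) ω) + r (x (k + 1) ω))) μ) :
    ∫ ω, ((f (x (k + 1) ω) + r (x (k + 1) ω)) - (F k ω (x (k + 1) ω) + r (x (k + 1) ω))) ∂μ
      ≤ (1 / (2 * L) + 3 * L * s ^ 2) * σ ^ 2 / N k
        + 3 * L * (s - c) ^ 2 * (Lr + 3 * Bg) ^ 2 * (μ {ω | t k ω ≠ if k = 0 then s else t (k - 1) ω}).toReal := by
  have hP : IsProxMap S r prox := ⟨hprox_mem, hprox_min⟩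
  have hBg_nonneg : 0 ≤ Bg := (norm_nonneg _).trans (hBg x₀ hx₀)
  have hcpos : 0 < c := by
    have h1 := hα.2
    have h2 := hβ.1
    rw [hc]
    refine lt_min hs (div_pos (mul_pos ?_ h2) hL)
    linarith
  have hcs : c ≤ s := hc ▸ min_le_left _ _
  have hxS : ∀ j, ∀ᵐ ω ∂μ, x j ω ∈ S := by
    intro j
    cases j with
    | zero => exact Eventually.of_forall fun ω => (hx₀det ω).symm ▸ hx₀
    | succ j =>
      filter_upwards [hupdate j, htbd j] with ω h ht
      rw [h]
      exact hP.mem _ (hcpos.trans_le ht.1) _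
  set τ : Ω → ℝ := fun ω => if k = 0 then s else t (k - 1) ω
  have hτmeas : StronglyMeasurable[ℱ k] τ := by
    cases k with
    | zero => exact stronglyMeasurable_const
    | succ j => exact htmeas j
  have hτbd : ∀ᵐ ω ∂μ, τ ω ∈ Set.Icc c s := by
    cases k with
    | zero => exact Eventually.of_forall fun ω => ⟨hcs, le_rfl⟩
    | succ j => exact htbd j
  obtain ⟨τ', hτ'meas, hτ'mem, hτ'eq⟩ := exists_stronglyMeasurable_forall_mem_ae_eq hτmeas
    isClosed_Icc (Set.nonempty_Icc.2 hcs) hτbd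
  obtain ⟨x', hx'meas, hx'mem, hx'eq⟩ := exists_stronglyMeasurable_forall_mem_ae_eq (hxmeas k)
    hSclosed hSne (hxS k)
  have hτ'pos : ∀ ω, 0 < τ' ω := fun ω => hcpos.trans_le (hτ'mem ω).1
  have hgcont : ContinuousOn g S :=
    (LipschitzOnWith.of_dist_le_mul (K := L.toNNReal) fun z hz w hw => by
      rw [dist_eq_norm, dist_eq_norm, Real.coe_toNNReal _ hL.le]
      exact hglip z hz w hw).continuousOn
  set y : Ω → EuclideanSpace ℝ (Fin n) :=
    fun ω => prox (τ' ω) (x' ω - τ' ω • g (x' ω))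
  have hymeas : StronglyMeasurable[ℱ k] y :=
    hP.stronglyMeasurable_step hrconv hgcont hτ'meas hτ'pos hx'meas hx'mem
  have hymem : ∀ ω, y ω ∈ S := fun ω => hP.mem _ (hτ'pos ω) _
  obtain ⟨hFint, hFcond⟩ := horacle_f k y hymeas hymem
  have hfint : Integrable (fun ω => f (y ω)) μ := integrable_condExp.congr hFcond
  have hmean : ∫ ω, f (y ω) ∂μ = ∫ ω, F k ω (y ω) ∂μ := by
    rw [← integral_congr_ae hFcond, integral_condExp (ℱ.le k)]
  obtain ⟨hvyint, hvycond⟩ := horacle_var k y hymeas hymem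
  obtain ⟨hvxint, hvxcond⟩ := horacle_var k x' hx'meas hx'mem
  have hvy := integral_le_of_condExp_le (ℱ.le k) hvycond
  have hvx := integral_le_of_condExp_le (ℱ.le k) hvxcond
  set A : Set Ω := {ω | t k ω ≠ τ ω}
  have hAmeas : MeasurableSet A :=
    (measurableSet_eq_fun ((htmeas k).mono (ℱ.le (k + 1))).measurable
      (hτmeas.mono (ℱ.le k)).measurable).compl
  set C : ℝ := 3 * L * (s - c) ^ 2 * (Lr + 3 * Bg) ^ 2 with hC
  have hpt : ∀ᵐ ω ∂μ,
      (f (x (k + 1) ω) + r (x (k + 1) ω)) - (F k ω (x (k + 1) ω) + r (x (k + 1) ω))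
      ≤ (f (y ω) - F k ω (y ω)) + 1 / (2 * L) * ‖GF k ω (y ω) - g (y ω)‖ ^ 2
        + 3 * L * s ^ 2 * ‖GF k ω (x' ω) - g (x' ω)‖ ^ 2 + A.indicator (fun _ => C) ω := by
    filter_upwards [hupdate k, htbd k, hFgrad k, hxS (k + 1), hτ'eq, hx'eq]
      with ω hup ht hF hxs hτω hxω
    have hgap := sub_le_sub_add_norm_gradient_sub_sq hrconv.1 hL (fun z hz => hf z (hSU hz)) hglip
      (fun z hz => hF.1 z (hSU hz)) hF.2 (hymem ω) hxs
    have hdist := hP.norm_inexact_step_sub_step_le hrconv hLr hrlip (hcpos.trans_le ht.1)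
      (hτ'pos ω) (hx'mem ω) (GF k ω (x' ω)) (g (x' ω))
    rw [hxω, ← hup, ← hxω] at hdist
    have hsq : ‖x (k + 1) ω - y ω‖ ^ 2
        ≤ 2 * (s ^ 2 * ‖GF k ω (x' ω) - g (x' ω)‖ ^ 2)
          + 2 * (|t k ω - τ' ω| ^ 2 * (Lr + 3 * Bg) ^ 2) := by
      have hd : ‖x (k + 1) ω - y ω‖
          ≤ s * ‖GF k ω (x' ω) - g (x' ω)‖ + |t k ω - τ' ω| * (Lr + 3 * Bg) := by
        refine hdist.trans (add_le_add (mul_le_mul_of_nonneg_right ht.2 (norm_nonneg _))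
          (mul_le_mul_of_nonneg_left ?_ (abs_nonneg _)))
        linarith [hBg _ (hx'mem ω)]
      have h := (pow_le_pow_left₀ (norm_nonneg _) hd 2).trans add_sq_le
      rw [mul_pow, mul_pow] at h
      linarith
    have hind : 3 * L * (|t k ω - τ' ω| ^ 2 * (Lr + 3 * Bg) ^ 2)
        ≤ A.indicator (fun _ => C) ω := by
      by_cases hω : ω ∈ A
      · rw [Set.indicator_of_mem hω]
        have habs : |t k ω - τ' ω| ≤ s - c := by
          have h := hτ'mem ω
          exact abs_sub_le_iff.2 ⟨by linarith [h.1, ht.2], by linarith [h.2, ht.1]⟩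
        have h2 := pow_le_pow_left₀ (abs_nonneg _) habs 2
        rw [hC, mul_assoc (3 * L)]
        gcongr
      · rw [Set.indicator_of_notMem hω]
        have h : t k ω = τ ω := not_not.1 hω
        rw [h, hτω]
        simp
    have hscaled := mul_le_mul_of_nonneg_left hsq (by positivity : 0 ≤ 3 * L / 2)
    linarith
  have hgap_int : Integrable (fun ω => f (y ω) - F k ω (y ω)) μ := hfint.sub hFint
  have hvy_int := hvyint.const_mul (1 / (2 * L))
  have hvx_int := hvxint.const_mul (3 * L * s ^ 2)
  have hind_int : Integrable (A.indicator fun _ => C) μ := (integrable_const C).indicator hAmeas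
  have hle := integral_mono_ae hgapint (((hgap_int.add hvy_int).add hvx_int).add hind_int) hpt
  refine hle.trans ?_
  rw [integral_add' ((hgap_int.add hvy_int).add hvx_int) hind_int,
    integral_add' (hgap_int.add hvy_int) hvx_int, integral_add' hgap_int hvy_int,
    integral_sub hfint hFint, hmean, sub_self, zero_add, integral_const_mul, integral_const_mul,
    integral_indicator_const _ hAmeas, smul_eq_mul, mul_comm (μ.real A) C, mul_div_assoc, add_mul]
  have h1 := mul_le_mul_of_nonneg_left hvy (by positivity : 0 ≤ 1 / (2 * L))
  have h2 := mul_le_mul_of_nonneg_left hvx (by positivity : 0 ≤ 3 * L * s ^ 2)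
  exact add_le_add (add_le_add h1 h2) le_rfl
end

section
/- Under the standing stochastic setup, suppose in addition that the sampled Armijo condition holds at iteration k, i.e., almost surely f̃_k(x_{k+1}) + r(x_{k+1}) ≤ f̃_k(x_k) + r(x_k) − (α/t_k)‖x_k − x_{k+1}‖². Then E[φ(x_{k+1})] ≤ E[φ(x_k)] − (α c/2) E[‖G_s(x_k)‖²] + (1/(2L) + 3 L s² + α c) σ²/N_k + 3 L (s − c)² (L_r + 3 B_g)² ℙ(t_k ≠ t_{k−1}). -/
open MeasureTheory Filter
open scoped RealInnerProductSpace

section ProximalMap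

variable {E : Type*} [NormedAddCommGroup E] [InnerProductSpace ℝ E]

/-- `p` minimizes `y ↦ r y + ‖y - z‖² / (2t)` over `S`. -/
def IsProxPoint (S : Set E) (r : E → ℝ) (t : ℝ) (z p : E) : Prop :=
  p ∈ S ∧ ∀ y ∈ S, r p + ‖p - z‖ ^ 2 / (2 * t) ≤ r y + ‖y - z‖ ^ 2 / (2 * t)

variable {S : Set E} {r : E → ℝ}

lemma IsProxPoint.inner_le (hr : ConvexOn ℝ S r) {t : ℝ} (ht : 0 < t) {z p : E}
    (hp : IsProxPoint S r t z p) {y : E} (hy : y ∈ S) :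
    ⟪z - p, y - p⟫ ≤ t * (r y - r p) := by
  obtain ⟨hpS, hmin⟩ := hp
  have key : ∀ θ ∈ Set.Ioo (0 : ℝ) 1,
      ⟪z - p, y - p⟫ - t * (r y - r p) ≤ θ * (‖y - p‖ ^ 2 / 2) := by
    intro θ hθ
    have hmem : (1 - θ) • p + θ • y ∈ S :=
      hr.1 hpS hy (by linarith [hθ.2]) hθ.1.le (by ring)
    have h1 := hr.2 hpS hy (by linarith [hθ.2] : (0 : ℝ) ≤ 1 - θ) hθ.1.le (by ring)
    have h2 := hmin _ hmem
    simp only [smul_eq_mul] at h1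
    have e : (1 - θ) • p + θ • y - z = θ • (y - p) - (z - p) := by
      module
    rw [e, norm_sub_sq_real (θ • (y - p)), norm_smul, inner_smul_left, norm_sub_rev p z,
      real_inner_comm, mul_pow, Real.norm_eq_abs, sq_abs] at h2
    simp only [conj_trivial] at h2
    have h3 : r p + ‖z - p‖ ^ 2 / (2 * t) ≤ (1 - θ) * r p + θ * r y
        + (θ ^ 2 * ‖y - p‖ ^ 2 - 2 * (θ * ⟪z - p, y - p⟫) + ‖z - p‖ ^ 2) / (2 * t) := by
      linarith
    have h4 : 0 ≤ θ * (r y - r p)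
        + (θ ^ 2 * ‖y - p‖ ^ 2 - 2 * (θ * ⟪z - p, y - p⟫)) / (2 * t) := by
      have := add_div (θ ^ 2 * ‖y - p‖ ^ 2 - 2 * (θ * ⟪z - p, y - p⟫)) (‖z - p‖ ^ 2) (2 * t)
      linarith
    have h5 := mul_nonneg h4 (by positivity : 0 ≤ 2 * t)
    rw [add_mul, div_mul_cancel₀ _ (by positivity)] at h5
    have h6 : 0 ≤ θ * (2 * t * (r y - r p) + θ * ‖y - p‖ ^ 2 - 2 * ⟪z - p, y - p⟫) := by
      linarith
    have := nonneg_of_mul_nonneg_right h6 hθ.1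
    linarith
  have hlim : Tendsto (fun θ : ℝ => θ * (‖y - p‖ ^ 2 / 2)) (nhdsWithin 0 (Set.Ioi 0))
      (nhds 0) := by
    have : Tendsto (fun θ : ℝ => θ * (‖y - p‖ ^ 2 / 2)) (nhds 0) (nhds (0 * (‖y - p‖ ^ 2 / 2))) :=
      (continuous_id.mul continuous_const).tendsto 0
    rw [zero_mul] at this
    exact this.mono_left nhdsWithin_le_nhds
  have := ge_of_tendsto hlim
    (Filter.mem_of_superset (Ioo_mem_nhdsGT (zero_lt_one' ℝ)) key)
  linarith

lemma IsProxPoint.norm_sub_le (hr : ConvexOn ℝ S r) {t : ℝ} (ht : 0 < t) {z w p q : E}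
    (hp : IsProxPoint S r t z p) (hq : IsProxPoint S r t w q) : ‖p - q‖ ≤ ‖z - w‖ := by
  have h1 := hp.inner_le hr ht hq.1
  have h2 := hq.inner_le hr ht hp.1
  have h3 : ‖p - q‖ ^ 2 ≤ ⟪z - w, p - q⟫ := by
    have e : ⟪z - w, p - q⟫ = -⟪z - p, q - p⟫ - ⟪w - q, p - q⟫ + ⟪p - q, p - q⟫ := by
      simp only [inner_sub_left, inner_sub_right]; ring
    rw [e, real_inner_self_eq_norm_sq]
    linarith
  have h4 := h3.trans (real_inner_le_norm _ _)
  by_contra! h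
  nlinarith [norm_nonneg (p - q), norm_nonneg (z - w)]

lemma IsProxPoint.norm_sub_le_step (hr : ConvexOn ℝ S r) {Lr B : ℝ} (hLr : 0 ≤ Lr)
    (hrlip : ∀ z ∈ S, ∀ w ∈ S, |r z - r w| ≤ Lr * ‖z - w‖) {t τ : ℝ} (ht : 0 < t) (hτ : 0 < τ)
    {x v p q : E} (hv : ‖v‖ ≤ B) (hp : IsProxPoint S r t (x - t • v) p)
    (hq : IsProxPoint S r τ (x - τ • v) q) : ‖p - q‖ ≤ |t - τ| * (Lr + B) := by
  have h1 := hp.inner_le hr ht hq.1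
  have h2 := hq.inner_le hr hτ hp.1
  have h3 : ‖p - q‖ ^ 2 ≤ (t - τ) * (r q - r p) + (t - τ) * ⟪v, q - p⟫ := by
    have e : ‖p - q‖ ^ 2 = ⟪x - t • v - p, q - p⟫ + ⟪x - τ • v - q, p - q⟫
        + (t - τ) * ⟪v, q - p⟫ := by
      rw [← real_inner_self_eq_norm_sq]
      simp only [inner_sub_left, inner_sub_right, inner_smul_left, conj_trivial]; ring
    rw [e]
    linarith
  have h4 : (t - τ) * (r q - r p) ≤ |t - τ| * (Lr * ‖p - q‖) := by
    refine (le_abs_self _).trans ?_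
    rw [abs_mul, norm_sub_rev p q]
    exact mul_le_mul_of_nonneg_left (hrlip q hq.1 p hp.1) (abs_nonneg _)
  have h5 : (t - τ) * ⟪v, q - p⟫ ≤ |t - τ| * (B * ‖p - q‖) := by
    refine (le_abs_self _).trans ?_
    rw [abs_mul, norm_sub_rev p q]
    refine mul_le_mul_of_nonneg_left ((abs_real_inner_le_norm _ _).trans ?_) (abs_nonneg _)
    gcongr
  rcases (norm_nonneg (p - q)).eq_or_lt with h0 | h0
  · have hB := (norm_nonneg v).trans hv
    exact h0 ▸ by positivity
  · have : ‖p - q‖ * ‖p - q‖ ≤ (|t - τ| * (Lr + B)) * ‖p - q‖ := by nlinarith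
    exact le_of_mul_le_mul_right this h0

/-- The norm of the gradient mapping is nonincreasing in the step size. -/
lemma IsProxPoint.norm_div_antitone (hr : ConvexOn ℝ S r) {t s : ℝ} (ht : 0 < t) (hts : t ≤ s)
    {x v p q : E} (hp : IsProxPoint S r t (x - t • v) p)
    (hq : IsProxPoint S r s (x - s • v) q) : ‖x - q‖ / s ≤ ‖x - p‖ / t := by
  have hs : 0 < s := ht.trans_le hts
  have h1 := hp.inner_le hr ht hq.1
  have h2 := hq.inner_le hr hs hp.1
  have e1 : ⟪x - t • v - p, q - p⟫ = ‖x - p‖ ^ 2 - ⟪x - p, x - q⟫ - t * ⟪v, q - p⟫ := by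
    rw [← real_inner_self_eq_norm_sq]
    simp only [inner_sub_left, inner_sub_right, inner_smul_left, conj_trivial]; ring
  have e2 : ⟪x - s • v - q, p - q⟫ = ‖x - q‖ ^ 2 - ⟪x - p, x - q⟫ + s * ⟪v, q - p⟫ := by
    rw [← real_inner_self_eq_norm_sq, real_inner_comm (x - q) (x - p)]
    simp only [inner_sub_left, inner_sub_right, inner_smul_left, conj_trivial]; ring
  rw [e1] at h1
  rw [e2] at h2
  have hcs := real_inner_le_norm (x - p) (x - q)
  have h3 : (s * ‖x - p‖ - t * ‖x - q‖) * (‖x - p‖ - ‖x - q‖) ≤ 0 := by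
    nlinarith [mul_le_mul_of_nonneg_left h1 hs.le, mul_le_mul_of_nonneg_left h2 ht.le,
      mul_le_mul_of_nonneg_left hcs (add_pos hs ht).le]
  rw [div_le_div_iff₀ hs ht]
  by_contra! h
  have h4 : ‖x - p‖ < ‖x - q‖ := by
    have := mul_le_mul_of_nonneg_right hts (norm_nonneg (x - q))
    by_contra! h'
    nlinarith [mul_le_mul_of_nonneg_left h' hs.le]
  nlinarith

lemma descent_of_lipschitz_gradient [CompleteSpace E] (hS : Convex ℝ S) {D : E → ℝ} {G : E → E}
    (hD : ∀ z ∈ S, HasGradientAt D (G z) z) {M : ℝ}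
    (hG : ∀ z ∈ S, ∀ w ∈ S, ‖G z - G w‖ ≤ M * ‖z - w‖) {y z : E} (hy : y ∈ S) (hz : z ∈ S) :
    D z ≤ D y + ⟪G y, z - y⟫ + M / 2 * ‖z - y‖ ^ 2 := by
  let q : ℝ → ℝ := fun θ => D (y + θ • (z - y)) - θ * ⟪G y, z - y⟫ - θ ^ 2 * (M / 2 * ‖z - y‖ ^ 2)
  have hmem : ∀ θ ∈ Set.Icc (0 : ℝ) 1, y + θ • (z - y) ∈ S := fun θ hθ =>
    hS.add_smul_sub_mem hy hz hθ
  have hderiv : ∀ θ ∈ Set.Icc (0 : ℝ) 1, HasDerivAt q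
      (⟪G (y + θ • (z - y)), z - y⟫ - 1 * ⟪G y, z - y⟫
        - (2 * θ) * (M / 2 * ‖z - y‖ ^ 2)) θ := by
    intro θ hθ
    have hl : HasDerivAt (fun θ : ℝ => y + θ • (z - y)) ((1 : ℝ) • (z - y)) θ :=
      ((hasDerivAt_id θ).smul_const (z - y)).const_add y
    have hc := (hD _ (hmem θ hθ)).hasFDerivAt.comp_hasDerivAt θ hl
    rw [one_smul, InnerProductSpace.toDual_apply_apply] at hc
    have h2 := ((hasDerivAt_id θ).pow 2).mul_const (M / 2 * ‖z - y‖ ^ 2)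
    have h3 := (hc.sub ((hasDerivAt_id θ).mul_const ⟪G y, z - y⟫)).sub h2
    refine h3.congr_deriv ?_
    simp
  have hanti : AntitoneOn q (Set.Icc 0 1) := by
    refine antitoneOn_of_deriv_nonpos (convex_Icc 0 1)
      (fun θ hθ => (hderiv θ hθ).continuousAt.continuousWithinAt)
      (fun θ hθ => (hderiv θ (interior_subset hθ)).differentiableAt.differentiableWithinAt) ?_
    intro θ hθ
    have hθ' := interior_subset hθ
    rw [(hderiv θ hθ').deriv, one_mul, ← inner_sub_left]
    have h1 := hG _ (hmem θ hθ') y hy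
    rw [add_sub_cancel_left, norm_smul, Real.norm_eq_abs, abs_of_nonneg hθ'.1] at h1
    have h2 := (real_inner_le_norm (G (y + θ • (z - y)) - G y) (z - y)).trans
      (mul_le_mul_of_nonneg_right h1 (norm_nonneg _))
    linarith
  have h := hanti (Set.left_mem_Icc.2 zero_le_one) (Set.right_mem_Icc.2 zero_le_one) zero_le_one
  simp only [q, one_smul, zero_smul, add_sub_cancel, add_zero] at h
  linarith

lemma norm_sub_sq_le_of_prox_steps (hr : ConvexOn ℝ S r) {Lr : ℝ} (hLr : 0 ≤ Lr)
    (hrlip : ∀ z ∈ S, ∀ w ∈ S, |r z - r w| ≤ Lr * ‖z - w‖) {B c s t τ : ℝ} (hc : 0 < c)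
    (ht : c ≤ t ∧ t ≤ s) (hτ : c ≤ τ ∧ τ ≤ s) {x v w p q : E} (hv : ‖v‖ ≤ B)
    (hex : ∃ p', IsProxPoint S r t (x - t • v) p')
    (hp : IsProxPoint S r t (x - t • w) p) (hq : IsProxPoint S r τ (x - τ • v) q) :
    ‖p - q‖ ^ 2 ≤ 2 * (s ^ 2 * ‖w - v‖ ^ 2)
      + 2 * (if t ≠ τ then (s - c) ^ 2 * (Lr + B) ^ 2 else 0) := by
  obtain ⟨p', hp'⟩ := hex
  have ht0 : 0 < t := hc.trans_le ht.1
  have hB : 0 ≤ B := (norm_nonneg v).trans hv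
  have h1 : ‖p - p'‖ ≤ s * ‖w - v‖ := by
    refine (hp.norm_sub_le hr ht0 hp').trans ?_
    have e : x - t • w - (x - t • v) = -(t • (w - v)) := by module
    rw [e, norm_neg, norm_smul, Real.norm_eq_abs, abs_of_pos ht0]
    gcongr
    exact ht.2
  have h2 := hp'.norm_sub_le_step hr hLr hrlip ht0 (hc.trans_le hτ.1) hv hq
  have h3 : ‖p' - q‖ ^ 2 ≤ if t ≠ τ then (s - c) ^ 2 * (Lr + B) ^ 2 else 0 := by
    split_ifs with h
    · have habs : |t - τ| ≤ s - c := abs_le.2 ⟨by linarith, by linarith⟩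
      rw [← mul_pow]
      exact pow_le_pow_left₀ (norm_nonneg _)
        (h2.trans (mul_le_mul_of_nonneg_right habs (by positivity))) 2
    · rw [not_not] at h
      rw [h, sub_self, abs_zero, zero_mul] at h2
      rw [le_antisymm h2 (norm_nonneg _)]
      norm_num
  have h4 := pow_le_pow_left₀ (norm_nonneg _) (norm_sub_le_norm_sub_add_norm_sub p p' q) 2
  have h5 := pow_le_pow_left₀ (norm_nonneg _) h1 2
  rw [mul_pow] at h5
  linarith [sq_nonneg (‖p - p'‖ - ‖p' - q‖)]

lemma sq_norm_gradient_mapping_le (hr : ConvexOn ℝ S r) {c s t : ℝ} (hc : 0 < c)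
    (ht : c ≤ t ∧ t ≤ s) {x v w p q : E}
    (hex : ∃ q', IsProxPoint S r s (x - s • w) q')
    (hp : IsProxPoint S r t (x - t • w) p) (hq : IsProxPoint S r s (x - s • v) q) :
    c * ‖(1 / s) • (x - q)‖ ^ 2 ≤ 2 * (‖x - p‖ ^ 2 / t) + 2 * (c * ‖w - v‖ ^ 2) := by
  obtain ⟨q', hq'⟩ := hex
  have ht0 : 0 < t := hc.trans_le ht.1
  have hs : 0 < s := ht0.trans_le ht.2
  have h1 := hp.norm_div_antitone hr ht0 ht.2 hq'
  have h2 : ‖q' - q‖ ≤ s * ‖w - v‖ := by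
    refine (hq'.norm_sub_le hr hs hq).trans ?_
    have e : x - s • w - (x - s • v) = -(s • (w - v)) := by module
    rw [e, norm_neg, norm_smul, Real.norm_eq_abs, abs_of_pos hs]
  have h3 : ‖(1 / s) • (x - q)‖ ≤ ‖x - p‖ / t + ‖w - v‖ := by
    rw [norm_smul, Real.norm_eq_abs, abs_of_pos (one_div_pos.2 hs), one_div_mul_eq_div]
    calc ‖x - q‖ / s ≤ (‖x - q'‖ + ‖q' - q‖) / s := by
          gcongr
          exact norm_sub_le_norm_sub_add_norm_sub x q' q
      _ = ‖x - q'‖ / s + ‖q' - q‖ / s := add_div _ _ _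
      _ ≤ ‖x - p‖ / t + ‖w - v‖ := add_le_add h1 ((div_le_iff₀' hs).2 h2)
  have h4 := pow_le_pow_left₀ (norm_nonneg _) h3 2
  have h5 : c * (‖x - p‖ / t) ^ 2 ≤ ‖x - p‖ ^ 2 / t := by
    calc c * (‖x - p‖ / t) ^ 2 ≤ t * (‖x - p‖ / t) ^ 2 := by gcongr; exact ht.1
      _ = ‖x - p‖ ^ 2 / t := by field_simp
  nlinarith [sq_nonneg (‖x - p‖ / t - ‖w - v‖)]

/-- The difference of two functions with `L`-Lipschitz gradients, compared at a point `z` and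
at a reference point `y`. -/
lemma sub_le_of_lipschitz_gradients [CompleteSpace E] (hS : Convex ℝ S) {f f' : E → ℝ}
    {G G' : E → E} (hf : ∀ z ∈ S, HasGradientAt f (G z) z)
    (hf' : ∀ z ∈ S, HasGradientAt f' (G' z) z) {L : ℝ} (hL : 0 < L)
    (hG : ∀ z ∈ S, ∀ w ∈ S, ‖G z - G w‖ ≤ L * ‖z - w‖)
    (hG' : ∀ z ∈ S, ∀ w ∈ S, ‖G' z - G' w‖ ≤ L * ‖z - w‖) {y z : E} (hy : y ∈ S) (hz : z ∈ S) :
    f z - f' z ≤ f y - f' y + 1 / (2 * L) * ‖G' y - G y‖ ^ 2 + 3 * L / 2 * ‖z - y‖ ^ 2 := by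
  have hD : ∀ z ∈ S, HasGradientAt (fun z => f z - f' z) (G z - G' z) z := fun z hz => by
    rw [hasGradientAt_iff_hasFDerivAt, map_sub]
    exact (hf z hz).hasFDerivAt.sub (hf' z hz).hasFDerivAt
  have hlip : ∀ z ∈ S, ∀ w ∈ S, ‖(G z - G' z) - (G w - G' w)‖ ≤ (2 * L) * ‖z - w‖ := by
    intro z hz w hw
    rw [sub_sub_sub_comm]
    linarith [norm_sub_le (G z - G w) (G' z - G' w), hG z hz w hw, hG' z hz w hw]
  have h1 := descent_of_lipschitz_gradient hS hD hlip hy hz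
  have h2 := real_inner_le_norm (G y - G' y) (z - y)
  rw [norm_sub_rev (G y)] at h2
  have h3 : ‖G' y - G y‖ * ‖z - y‖ ≤ 1 / (2 * L) * ‖G' y - G y‖ ^ 2 + L / 2 * ‖z - y‖ ^ 2 := by
    have e : 1 / (2 * L) * ‖G' y - G y‖ ^ 2 + L / 2 * ‖z - y‖ ^ 2 - ‖G' y - G y‖ * ‖z - y‖
        = 1 / (2 * L) * (‖G' y - G y‖ - L * ‖z - y‖) ^ 2 := by
      field_simp; ring
    have : 0 ≤ 1 / (2 * L) * (‖G' y - G y‖ - L * ‖z - y‖) ^ 2 := by positivity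
    linarith
  linarith

lemma lipschitz_prox_step (hr : ConvexOn ℝ S r) {Lr : ℝ} (hLr : 0 ≤ Lr)
    (hrlip : ∀ z ∈ S, ∀ w ∈ S, |r z - r w| ≤ Lr * ‖z - w‖) {prox : ℝ → E → E}
    (hprox : ∀ t : ℝ, 0 < t → ∀ z, IsProxPoint S r t z (prox t z)) {g : E → E} {L B c s : ℝ}
    (hL : 0 < L) (hg : ∀ z ∈ S, ∀ w ∈ S, ‖g z - g w‖ ≤ L * ‖z - w‖) (hB : ∀ z ∈ S, ‖g z‖ ≤ B)
    (hB0 : 0 ≤ B) (hc : 0 < c) (hs : 0 < s) :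
    LipschitzOnWith (Real.toNNReal (1 + s * L + (Lr + B)))
      (fun a : ℝ × E => prox a.1 (a.2 - a.1 • g a.2)) (Set.Icc c s ×ˢ S) := by
  refine LipschitzOnWith.of_dist_le_mul ?_
  rintro ⟨t, x⟩ ⟨ht, hx⟩ ⟨τ, y⟩ ⟨hτ, hy⟩
  simp only at ht hx hτ hy
  have ht0 : 0 < t := hc.trans_le ht.1
  rw [Real.coe_toNNReal _ (by positivity), Prod.dist_eq]
  simp only [dist_eq_norm]
  have h1 := (hprox t ht0 (x - t • g x)).norm_sub_le hr ht0 (hprox t ht0 (y - t • g y))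
  have h2 := (hprox t ht0 (y - t • g y)).norm_sub_le_step hr hLr hrlip ht0 (hc.trans_le hτ.1)
    (hB y hy) (hprox τ (hc.trans_le hτ.1) (y - τ • g y))
  have h3 : ‖x - t • g x - (y - t • g y)‖ ≤ (1 + s * L) * ‖x - y‖ := by
    have e : x - t • g x - (y - t • g y) = (x - y) - t • (g x - g y) := by module
    rw [e]
    refine (norm_sub_le _ _).trans ?_
    rw [norm_smul, Real.norm_eq_abs, abs_of_pos ht0]
    have : t * ‖g x - g y‖ ≤ s * (L * ‖x - y‖) :=
      mul_le_mul ht.2 (hg x hx y hy) (norm_nonneg _) hs.le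
    linarith
  refine (norm_sub_le_norm_sub_add_norm_sub _ (prox t (y - t • g y)) _).trans ?_
  have h4 : (1 + s * L) * ‖x - y‖ ≤ (1 + s * L) * max ‖t - τ‖ ‖x - y‖ := by
    gcongr; exact le_max_right _ _
  have h5 : |t - τ| * (Lr + B) ≤ max ‖t - τ‖ ‖x - y‖ * (Lr + B) := by
    gcongr; exact le_max_left _ _
  linarith

end ProximalMap

/-- Composing a measurable map with values in a closed set with a function continuous on it. -/
lemma ContinuousOn.comp_measurable_of_mem {X Y Z : Type*} [TopologicalSpace X]
    [MeasurableSpace X] [OpensMeasurableSpace X] [TopologicalSpace Y] [MeasurableSpace Y]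
    [BorelSpace Y] {m : MeasurableSpace Z} {h : X → Y} {A : Set X} (hh : ContinuousOn h A)
    {u : Z → X} (hu : Measurable u) (huA : ∀ z, u z ∈ A) : Measurable fun z => h (u z) :=
  hh.domRestrict.measurable.comp (hu.subtype_mk (h := huA))

theorem stmt9 {n : ℕ} {Ω : Type*} {m0 : MeasurableSpace Ω} {μ : Measure Ω}
    [IsProbabilityMeasure μ] (ℱ : Filtration ℕ m0)
    (S : Set (EuclideanSpace ℝ (Fin n))) (hSne : S.Nonempty) (hSclosed : IsClosed S)
    (r : EuclideanSpace ℝ (Fin n) → ℝ) (hrconv : ConvexOn ℝ S r)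
    (Lr : ℝ) (hLr : 0 ≤ Lr)
    (hrlip : ∀ z ∈ S, ∀ w ∈ S, |r z - r w| ≤ Lr * ‖z - w‖)
    (prox : ℝ → EuclideanSpace ℝ (Fin n) → EuclideanSpace ℝ (Fin n))
    (hprox_mem : ∀ t : ℝ, 0 < t → ∀ z, prox t z ∈ S)
    (hprox_min : ∀ t : ℝ, 0 < t → ∀ z, ∀ y ∈ S,
      r (prox t z) + ‖prox t z - z‖ ^ 2 / (2 * t) ≤ r y + ‖y - z‖ ^ 2 / (2 * t))
    (hprox_uniq : ∀ t : ℝ, 0 < t → ∀ z, ∀ y ∈ S,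
      (∀ y' ∈ S, r y + ‖y - z‖ ^ 2 / (2 * t) ≤ r y' + ‖y' - z‖ ^ 2 / (2 * t)) → y = prox t z)
    (f : EuclideanSpace ℝ (Fin n) → ℝ) (g : EuclideanSpace ℝ (Fin n) → EuclideanSpace ℝ (Fin n))
    (U : Set (EuclideanSpace ℝ (Fin n))) (hU : IsOpen U) (hSU : S ⊆ U)
    (hf : ∀ z ∈ U, HasGradientAt f (g z) z)
    (L : ℝ) (hL : 0 < L)
    (hglip : ∀ z ∈ S, ∀ w ∈ S, ‖g z - g w‖ ≤ L * ‖z - w‖)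
    (Bg : ℝ) (hBg : ∀ z ∈ S, ‖g z‖ ≤ Bg)
    (φinf : ℝ) (hφinf : ∀ z ∈ S, φinf ≤ f z + r z)
    (α β s : ℝ) (hα : α ∈ Set.Ioo (0:ℝ) 1) (hβ : β ∈ Set.Ioo (0:ℝ) 1) (hs : 0 < s)
    (c : ℝ) (hc : c = min s (2 * (1 - α) * β / L))
    (σ : ℝ) (hσ : 0 < σ)
    (N : ℕ → ℕ) (hN : ∀ k, 0 < N k)
    (x : ℕ → Ω → EuclideanSpace ℝ (Fin n)) (t : ℕ → Ω → ℝ)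
    (x₀ : EuclideanSpace ℝ (Fin n)) (hx₀ : x₀ ∈ S) (hx₀det : ∀ ω, x 0 ω = x₀)
    (hxmeas : ∀ k, StronglyMeasurable[ℱ k] (x k))
    (htmeas : ∀ k, StronglyMeasurable[ℱ (k + 1)] (t k))
    (htbd : ∀ k, ∀ᵐ ω ∂μ, c ≤ t k ω ∧ t k ω ≤ s)
    (F : ℕ → Ω → EuclideanSpace ℝ (Fin n) → ℝ) (GF : ℕ → Ω → EuclideanSpace ℝ (Fin n) → EuclideanSpace ℝ (Fin n))
    (hFgrad : ∀ k, ∀ᵐ ω ∂μ, (∀ z ∈ U, HasGradientAt (F k ω) (GF k ω z) z) ∧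
      ∀ z ∈ S, ∀ w ∈ S, ‖GF k ω z - GF k ω w‖ ≤ L * ‖z - w‖)
    (horacle_f : ∀ k, ∀ y : Ω → EuclideanSpace ℝ (Fin n),
      StronglyMeasurable[ℱ k] y → (∀ ω, y ω ∈ S) →
      Integrable (fun ω => F k ω (y ω)) μ ∧
        μ[(fun ω => F k ω (y ω))|ℱ k] =ᵐ[μ] fun ω => f (y ω))
    (horacle_g : ∀ k, ∀ y : Ω → EuclideanSpace ℝ (Fin n),
      StronglyMeasurable[ℱ k] y → (∀ ω, y ω ∈ S) →
      Integrable (fun ω => GF k ω (y ω)) μ ∧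
        μ[(fun ω => GF k ω (y ω))|ℱ k] =ᵐ[μ] fun ω => g (y ω))
    (horacle_var : ∀ k, ∀ y : Ω → EuclideanSpace ℝ (Fin n),
      StronglyMeasurable[ℱ k] y → (∀ ω, y ω ∈ S) →
      Integrable (fun ω => ‖GF k ω (y ω) - g (y ω)‖ ^ 2) μ ∧
        ∀ᵐ ω ∂μ, (μ[(fun ω' => ‖GF k ω' (y ω') - g (y ω')‖ ^ 2)|ℱ k]) ω ≤ σ ^ 2 / N k)
    (hupdate : ∀ k, ∀ᵐ ω ∂μ,
      x (k + 1) ω = prox (t k ω) (x k ω - t k ω • GF k ω (x k ω)))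
    (k : ℕ)
    (harmijo : ∀ᵐ ω ∂μ, F k ω (x (k + 1) ω) + r (x (k + 1) ω)
        ≤ F k ω (x k ω) + r (x k ω) - (α / t k ω) * ‖x k ω - x (k + 1) ω‖ ^ 2)
    (hφkint : Integrable (fun ω => f (x k ω) + r (x k ω)) μ)
    (hφk1int : Integrable (fun ω => f (x (k + 1) ω) + r (x (k + 1) ω)) μ)
    (hGint : Integrable (fun ω => ‖(1 / s) • (x k ω - prox s (x k ω - s • g (x k ω)))‖ ^ 2) μ)
    (hFint : Integrable (fun ω => F k ω (x (k + 1) ω) + r (x (k + 1) ω)) μ) :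
    ∫ ω, (f (x (k + 1) ω) + r (x (k + 1) ω)) ∂μ
      ≤ ∫ ω, (f (x k ω) + r (x k ω)) ∂μ
        - (α * c / 2) * ∫ ω, ‖(1 / s) • (x k ω - prox s (x k ω - s • g (x k ω)))‖ ^ 2 ∂μ
        + (1 / (2 * L) + 3 * L * s ^ 2 + α * c) * σ ^ 2 / N k
        + 3 * L * (s - c) ^ 2 * (Lr + 3 * Bg) ^ 2 * (μ {ω | t k ω ≠ if k = 0 then s else t (k - 1) ω}).toReal := by
  have hprox : ∀ τ : ℝ, 0 < τ → ∀ z, IsProxPoint S r τ z (prox τ z) := fun τ hτ z =>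
    ⟨hprox_mem τ hτ z, hprox_min τ hτ z⟩
  have hBg0 : 0 ≤ Bg := hSne.elim fun z hz => (norm_nonneg _).trans (hBg z hz)
  have hc0 : 0 < c := by
    rw [hc]
    refine lt_min hs (div_pos (mul_pos ?_ hβ.1) hL)
    linarith [hα.2]
  have hcs : c ≤ s := hc ▸ min_le_left _ _
  have hfS : ∀ z ∈ S, HasGradientAt f (g z) z := fun z hz => hf z (hSU hz)
  have hxS : ∀ j, ∀ᵐ ω ∂μ, x j ω ∈ S := by
    rintro (_ | j)
    · exact ae_of_all _ fun ω => hx₀det ω ▸ hx₀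
    · filter_upwards [hupdate j, htbd j] with ω h1 h2
      rw [h1]
      exact hprox_mem _ (hc0.trans_le h2.1) _
  -- everywhere-defined versions of the iterate, the previous step size and the exact step
  classical
  let x' : Ω → EuclideanSpace ℝ (Fin n) := fun ω => if x k ω ∈ S then x k ω else x₀
  let τ : Ω → ℝ := fun ω => if k = 0 then s else t (k - 1) ω
  let τ' : Ω → ℝ := fun ω => max c (min s (τ ω))
  let y : Ω → EuclideanSpace ℝ (Fin n) := fun ω => prox (τ' ω) (x' ω - τ' ω • g (x' ω))
  have hx'S : ∀ ω, x' ω ∈ S := fun ω => by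
    by_cases h : x k ω ∈ S <;> simp [x', h, hx₀]
  have hτ'I : ∀ ω, τ' ω ∈ Set.Icc c s := fun ω =>
    ⟨le_max_left _ _, max_le hcs (min_le_left _ _)⟩
  have hyS : ∀ ω, y ω ∈ S := fun ω => hprox_mem _ (hc0.trans_le (hτ'I ω).1) _
  have hx'm : Measurable[ℱ k] x' :=
    Measurable.ite ((hxmeas k).measurable hSclosed.measurableSet) (hxmeas k).measurable
      measurable_const
  have hτm : Measurable[ℱ k] τ := by
    rcases k with _ | j
    · simp [τ]
    · simpa [τ] using (htmeas j).measurable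
  have hτ'm : Measurable[ℱ k] τ' := measurable_const.max (measurable_const.min hτm)
  have hym : Measurable[ℱ k] y :=
    (lipschitz_prox_step hrconv hLr hrlip hprox hL hglip hBg hBg0 hc0
      hs).continuousOn.comp_measurable_of_mem (hτ'm.prodMk hx'm) fun ω => ⟨hτ'I ω, hx'S ω⟩
  have hx'eq : ∀ᵐ ω ∂μ, x' ω = x k ω := by
    filter_upwards [hxS k] with ω h
    simp [x', h]
  have hτ'eq : ∀ᵐ ω ∂μ, τ' ω = τ ω := by
    have hτI : ∀ᵐ ω ∂μ, c ≤ τ ω ∧ τ ω ≤ s := by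
      by_cases hk : k = 0
      · simp [τ, hk, hcs]
      · simpa [τ, hk] using htbd (k - 1)
    filter_upwards [hτI] with ω h
    simp [τ', h.1, h.2]
  obtain ⟨hFx, hFxc⟩ := horacle_f k x' hx'm.stronglyMeasurable hx'S
  obtain ⟨hFy, hFyc⟩ := horacle_f k y hym.stronglyMeasurable hyS
  obtain ⟨hVx, hVxc⟩ := horacle_var k x' hx'm.stronglyMeasurable hx'S
  obtain ⟨hVy, hVyc⟩ := horacle_var k y hym.stronglyMeasurable hyS
  have hfx : Integrable (fun ω => f (x' ω)) μ := integrable_condExp.congr hFxc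
  have hfy : Integrable (fun ω => f (y ω)) μ := integrable_condExp.congr hFyc
  have hmean : ∀ {A B : Ω → ℝ}, μ[A|ℱ k] =ᵐ[μ] B → ∫ ω, B ω ∂μ = ∫ ω, A ω ∂μ :=
    fun h => (integral_congr_ae h).symm.trans (integral_condExp (ℱ.le k))
  have hvar : ∀ {A : Ω → ℝ}, (∀ᵐ ω ∂μ, (μ[A|ℱ k]) ω ≤ σ ^ 2 / N k) →
      ∫ ω, A ω ∂μ ≤ σ ^ 2 / N k := fun h => by
    rw [← integral_condExp (ℱ.le k)]
    simpa using integral_mono_ae integrable_condExp (integrable_const _) h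
  have hVx' := hvar hVxc
  have hVy' := hvar hVyc
  have hset : MeasurableSet {ω | t k ω ≠ τ ω} :=
    (measurableSet_eq_fun ((htmeas k).mono (ℱ.le (k + 1))).measurable
      (hτm.mono (ℱ.le k) le_rfl)).compl
  have hφx : Integrable (fun ω => F k ω (x' ω) + (f (x k ω) + r (x k ω) - f (x' ω))) μ :=
    hFx.add (hφkint.sub hfx)
  have hφx_eq : ∫ ω, (F k ω (x' ω) + (f (x k ω) + r (x k ω) - f (x' ω))) ∂μ
      = ∫ ω, (f (x k ω) + r (x k ω)) ∂μ := by
    refine (integral_add hFx (hφkint.sub hfx)).trans ?_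
    rw [integral_sub' hφkint hfx, hmean hFxc]
    ring
  have hind : Integrable ({ω | t k ω ≠ τ ω}.indicator
      fun _ => (s - c) ^ 2 * (Lr + Bg) ^ 2) μ := (integrable_const _).indicator hset
  have hpoint : ∀ᵐ ω ∂μ, f (x (k + 1) ω) + r (x (k + 1) ω) ≤
      (F k ω (x' ω) + (f (x k ω) + r (x k ω) - f (x' ω)))
      - (α * c / 2) * ‖(1 / s) • (x k ω - prox s (x k ω - s • g (x k ω)))‖ ^ 2
      + (f (y ω) - F k ω (y ω))
      + 1 / (2 * L) * ‖GF k ω (y ω) - g (y ω)‖ ^ 2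
      + (3 * L * s ^ 2 + α * c) * ‖GF k ω (x' ω) - g (x' ω)‖ ^ 2
      + 3 * L * ({ω | t k ω ≠ τ ω}.indicator (fun _ => (s - c) ^ 2 * (Lr + Bg) ^ 2) ω) := by
    filter_upwards [hx'eq, hτ'eq, htbd k, hFgrad k, hupdate k, harmijo] with ω hx hτ ht hF hu ha
    have ht0 := hc0.trans_le ht.1
    have hxω : x k ω ∈ S := hx ▸ hx'S ω
    have hp : IsProxPoint S r (t k ω) (x k ω - t k ω • GF k ω (x k ω)) (x (k + 1) ω) :=
      hu ▸ hprox _ ht0 _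
    have hq : IsProxPoint S r (τ ω) (x k ω - τ ω • g (x k ω)) (y ω) := by
      have := hprox (τ' ω) (hc0.trans_le (hτ'I ω).1) (x' ω - τ' ω • g (x' ω))
      rwa [hτ, hx, show prox (τ ω) (x k ω - τ ω • g (x k ω)) = y ω by simp only [y, hτ, hx]]
        at this
    have h1 := sub_le_of_lipschitz_gradients hrconv.1 hfS (fun z hz => hF.1 z (hSU hz)) hL hglip
      hF.2 (hyS ω) hp.1
    have h2 := norm_sub_sq_le_of_prox_steps hrconv hLr hrlip hc0 ht (hτ ▸ hτ'I ω)
      (hBg _ hxω) ⟨_, hprox _ ht0 _⟩ hp hq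
    have h3 := sq_norm_gradient_mapping_le hrconv hc0 ht ⟨_, hprox s hs _⟩ hp
      (hprox s hs (x k ω - s • g (x k ω)))
    have h2' := mul_le_mul_of_nonneg_left h2 (by positivity : 0 ≤ 3 * L / 2)
    have h3' := mul_le_mul_of_nonneg_left h3 (half_pos hα.1).le
    have e : α / t k ω * ‖x k ω - x (k + 1) ω‖ ^ 2
        = α * (‖x k ω - x (k + 1) ω‖ ^ 2 / t k ω) := by ring
    rw [e] at ha
    rw [hx, Set.indicator_apply]
    simp only [Set.mem_ofPred_eq]
    linarith
  have hi1 := hφx.sub (hGint.const_mul (α * c / 2))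
  have hi2 := hi1.add (hfy.sub hFy)
  have hi3 := hi2.add (hVy.const_mul (1 / (2 * L)))
  have hi4 := hi3.add (hVx.const_mul (3 * L * s ^ 2 + α * c))
  have hfin := integral_mono_ae hφk1int (hi4.add (hind.const_mul (3 * L))) hpoint
  rw [integral_add' hi4 (hind.const_mul (3 * L)),
    integral_add' hi3 (hVx.const_mul _), integral_add' hi2 (hVy.const_mul _),
    integral_add' hi1 (hfy.sub hFy), integral_sub' hφx (hGint.const_mul _),
    integral_sub' hfy hFy, hφx_eq,
    integral_const_mul, integral_const_mul, integral_const_mul, integral_const_mul,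
    integral_indicator_const _ hset, hmean hFyc, smul_eq_mul, measureReal_def] at hfin
  have hα0 := hα.1
  have hV1 := mul_le_mul_of_nonneg_left hVy' (by positivity : 0 ≤ 1 / (2 * L))
  have hV2 := mul_le_mul_of_nonneg_left hVx' (by positivity : 0 ≤ 3 * L * s ^ 2 + α * c)
  have hB : 3 * L * ((μ {ω | t k ω ≠ τ ω}).toReal * ((s - c) ^ 2 * (Lr + Bg) ^ 2))
      ≤ 3 * L * (s - c) ^ 2 * (Lr + 3 * Bg) ^ 2 * (μ {ω | t k ω ≠ τ ω}).toReal := by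
    have h : (Lr + Bg) ^ 2 ≤ (Lr + 3 * Bg) ^ 2 :=
      pow_le_pow_left₀ (by positivity) (by linarith) 2
    calc _ = 3 * L * (s - c) ^ 2 * (Lr + Bg) ^ 2 * (μ {ω | t k ω ≠ τ ω}).toReal := by ring
      _ ≤ _ := by gcongr
  have e : (1 / (2 * L) + 3 * L * s ^ 2 + α * c) * σ ^ 2 / N k
      = 1 / (2 * L) * (σ ^ 2 / N k) + (3 * L * s ^ 2 + α * c) * (σ ^ 2 / N k) := by ring
  rw [e]
  linarith
end
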